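/- arXiv:2407.14715 — 4 statements merged into one kernel-verified Lean document; each statement's English description precedes it below -/
import Mathlib

section
/- Let m ≥ 2 be an integer and γ > 1/2 a real number. There exists a constant C > 0 such that the following holds. Let f : ℝ → ℝ be of class C^{m+1} with ‖f‖_{C^{m+1}} = max_{0 ≤ j ≤ m+1} sup_ℝ |f^{(j)}| < ∞, let ξ : 𝕋 → ℝ be smooth, and let v : (0,1] × 𝕋 → ℝ be smooth with ‖v‖_{K_γ^m} < ∞. Set u(ψ,θ) = ξ(θ) + v(ψ,θ) and N = ‖ξ‖_{H^m(𝕋)} + ‖v‖_{K_γ^m}. Then ‖f(ξ + v) − f(ξ)‖_{K_γ^m} ≤ C ‖f‖_{C^{m+1}} (N + N^{m+1}), where f(ξ+v) − f(ξ) denotes the function (ψ,θ) ↦ f(u(ψ,θ)) − f(ξ(θ)). -/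
open MeasureTheory Real Set ENNReal

noncomputable section

/-- The iterated partial derivative `∂_ψ^p ∂_θ^q w` of a real-valued `w(ψ,θ)`. -/
def pderR (p q : ℕ) (w : ℝ → ℝ → ℝ) : ℝ → ℝ → ℝ :=
  fun ψ θ => iteratedDeriv p (fun s => iteratedDeriv q (w s) θ) ψ

/-- The square of the Kondratev norm `‖w‖_{K_γ^m}` on `Π = (0,1] × 𝕋`. -/
def KNormSqR (γ : ℝ) (m : ℕ) (w : ℝ → ℝ → ℝ) : ℝ≥0∞ :=
  ∑ p ∈ Finset.range (m+1), ∑ q ∈ Finset.range (m+1-p),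
    ∫⁻ ψ in Ioc (0:ℝ) 1, ∫⁻ θ in Ioc (0:ℝ) (2*π),
      ENNReal.ofReal (ψ ^ (2*((p:ℝ) - γ)) * |pderR p q w ψ θ|^2)

/-- The Kondratev norm `‖w‖_{K_γ^m}`. -/
def KNormR (γ : ℝ) (m : ℕ) (w : ℝ → ℝ → ℝ) : ℝ≥0∞ := KNormSqR γ m w ^ ((1:ℝ)/2)

/-- `w : (0,1] × 𝕋 → ℝ` is smooth: (jointly) smooth for `ψ > 0` and `2π`-periodic in `θ`. -/
def SmoothAnnR (w : ℝ → ℝ → ℝ) : Prop :=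
  ContDiffOn ℝ (⊤ : ℕ∞) (Function.uncurry w) (Ioi (0:ℝ) ×ˢ (univ : Set ℝ)) ∧
    ∀ ψ θ, w ψ (θ + 2*π) = w ψ θ

/-- The Sobolev norm `‖ξ‖_{H^m(𝕋)}` of a real-valued function on the circle. -/
def HNormR (m : ℕ) (ξ : ℝ → ℝ) : ℝ≥0∞ :=
  (∑ q ∈ Finset.range (m+1), ∫⁻ θ in Ioc (0:ℝ) (2*π),
    ENNReal.ofReal (|iteratedDeriv q ξ θ|^2)) ^ ((1:ℝ)/2)

/-! ### Partial derivatives of smooth functions on the open annulus -/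

/-- Joint smoothness of `w(ψ,θ)` for `ψ > 0`. -/
abbrev SmoothPos (w : ℝ → ℝ → ℝ) : Prop :=
  ContDiffOn ℝ (⊤ : ℕ∞) (Function.uncurry w) (Ioi (0:ℝ) ×ˢ (univ : Set ℝ))

lemma isOpen_pos_prod_univ : IsOpen (Ioi (0:ℝ) ×ˢ (univ : Set ℝ)) :=
  isOpen_Ioi.prod isOpen_univ

lemma SmoothPos.hasDerivAt_left {w : ℝ → ℝ → ℝ} (hw : SmoothPos w) {ψ : ℝ} (hψ : 0 < ψ) (θ : ℝ) :
    HasDerivAt (fun s => w s θ) (fderiv ℝ (Function.uncurry w) (ψ, θ) (1, 0)) ψ := by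
  have hz : (ψ, θ) ∈ Ioi (0:ℝ) ×ˢ (univ : Set ℝ) := ⟨hψ, mem_univ _⟩
  have h := ((hw.differentiableOn (by simp)).differentiableAt
    (isOpen_pos_prod_univ.mem_nhds hz)).hasFDerivAt
  exact h.comp_hasDerivAt ψ ((hasDerivAt_id ψ).prodMk (hasDerivAt_const ψ θ))

lemma SmoothPos.hasDerivAt_right {w : ℝ → ℝ → ℝ} (hw : SmoothPos w) {ψ : ℝ} (hψ : 0 < ψ) (θ : ℝ) :
    HasDerivAt (w ψ) (fderiv ℝ (Function.uncurry w) (ψ, θ) (0, 1)) θ := by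
  have hz : (ψ, θ) ∈ Ioi (0:ℝ) ×ˢ (univ : Set ℝ) := ⟨hψ, mem_univ _⟩
  have h := ((hw.differentiableOn (by simp)).differentiableAt
    (isOpen_pos_prod_univ.mem_nhds hz)).hasFDerivAt
  exact h.comp_hasDerivAt θ ((hasDerivAt_const θ ψ).prodMk (hasDerivAt_id θ))

lemma SmoothPos.fderiv_apply {w : ℝ → ℝ → ℝ} (hw : SmoothPos w) (e : ℝ × ℝ) :
    ContDiffOn ℝ (⊤ : ℕ∞) (fun z => fderiv ℝ (Function.uncurry w) z e)
      (Ioi (0:ℝ) ×ˢ (univ : Set ℝ)) :=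
  (hw.fderiv_of_isOpen isOpen_pos_prod_univ (by simp)).clm_apply contDiffOn_const

lemma SmoothPos.deriv_left {w : ℝ → ℝ → ℝ} (hw : SmoothPos w) :
    SmoothPos (fun ψ θ => deriv (fun s => w s θ) ψ) :=
  (hw.fderiv_apply (1, 0)).congr fun z hz => (hw.hasDerivAt_left hz.1 z.2).deriv

lemma SmoothPos.deriv_right {w : ℝ → ℝ → ℝ} (hw : SmoothPos w) :
    SmoothPos (fun ψ θ => deriv (w ψ) θ) :=
  (hw.fderiv_apply (0, 1)).congr fun z hz => (hw.hasDerivAt_right hz.1 z.2).deriv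

lemma SmoothPos.deriv_comm {w : ℝ → ℝ → ℝ} (hw : SmoothPos w) {ψ : ℝ} (hψ : 0 < ψ) (θ : ℝ) :
    deriv (fun s => deriv (w s) θ) ψ = deriv (fun t => deriv (fun s => w s t) ψ) θ := by
  have hz : (ψ, θ) ∈ Ioi (0:ℝ) ×ˢ (univ : Set ℝ) := ⟨hψ, mem_univ _⟩
  have hn := isOpen_pos_prod_univ.mem_nhds hz
  have hd : DifferentiableAt ℝ (fderiv ℝ (Function.uncurry w)) (ψ, θ) :=
    ((hw.fderiv_of_isOpen (m := (⊤ : ℕ∞)) isOpen_pos_prod_univ (by simp)).differentiableOn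
      (by simp)).differentiableAt hn
  have hsymm : IsSymmSndFDerivAt ℝ (Function.uncurry w) (ψ, θ) :=
    (hw.contDiffAt hn).isSymmSndFDerivAt (by
      rw [minSmoothness_of_isRCLikeNormedField]; exact WithTop.coe_le_coe.2 le_top)
  have key : ∀ e : ℝ × ℝ, HasFDerivAt (fun z => fderiv ℝ (Function.uncurry w) z e)
      ((ContinuousLinearMap.apply ℝ ℝ e).comp (fderiv ℝ (fderiv ℝ (Function.uncurry w)) (ψ, θ)))
      (ψ, θ) := fun e =>
    (ContinuousLinearMap.apply ℝ ℝ e).hasFDerivAt.comp _ hd.hasFDerivAt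
  have h1 : (fun s => deriv (w s) θ) =ᶠ[nhds ψ]
      fun s => fderiv ℝ (Function.uncurry w) (s, θ) (0, 1) := by
    filter_upwards [Ioi_mem_nhds hψ] with s hs using (hw.hasDerivAt_right hs θ).deriv
  have h2 : (fun t => deriv (fun s => w s t) ψ) =
      fun t => fderiv ℝ (Function.uncurry w) (ψ, t) (1, 0) := by
    funext t
    exact (hw.hasDerivAt_left hψ t).deriv
  rw [h1.deriv_eq, h2]
  have e1 := (key (0, 1)).comp_hasDerivAt ψ ((hasDerivAt_id ψ).prodMk (hasDerivAt_const ψ θ))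
  have e2 := (key (1, 0)).comp_hasDerivAt θ ((hasDerivAt_const θ ψ).prodMk (hasDerivAt_id θ))
  refine e1.deriv.trans (Eq.trans ?_ e2.deriv.symm)
  exact hsymm.eq (1, 0) (0, 1)

lemma pderR_succ_left (p q : ℕ) (w : ℝ → ℝ → ℝ) :
    pderR (p+1) q w = fun ψ θ => deriv (fun s => pderR p q w s θ) ψ := by
  funext ψ θ
  simp only [pderR, iteratedDeriv_succ]

lemma pderR_zero_succ (q : ℕ) (w : ℝ → ℝ → ℝ) :
    pderR 0 (q+1) w = fun ψ θ => deriv (pderR 0 q w ψ) θ := by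
  funext ψ θ
  simp only [pderR, iteratedDeriv_zero, iteratedDeriv_succ]
  rfl

lemma pderR_zero_zero (w : ℝ → ℝ → ℝ) : pderR 0 0 w = w := by
  funext ψ θ
  simp [pderR]

lemma SmoothPos.pderR {w : ℝ → ℝ → ℝ} (hw : SmoothPos w) (p q : ℕ) : SmoothPos (pderR p q w) := by
  induction p with
  | zero =>
    induction q with
    | zero => rwa [pderR_zero_zero]
    | succ q ih => rw [pderR_zero_succ]; exact ih.deriv_right
  | succ p ih => rw [pderR_succ_left]; exact ih.deriv_left

lemma SmoothPos.pderR_succ_right {w : ℝ → ℝ → ℝ} (hw : SmoothPos w) (p q : ℕ) {ψ : ℝ}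
    (hψ : 0 < ψ) (θ : ℝ) :
    _root_.pderR p (q+1) w ψ θ = deriv (_root_.pderR p q w ψ) θ := by
  induction p generalizing ψ θ with
  | zero => rw [pderR_zero_succ]
  | succ p ih =>
    rw [pderR_succ_left, pderR_succ_left]
    have h1 : (fun s => _root_.pderR p (q+1) w s θ) =ᶠ[nhds ψ]
        fun s => deriv (_root_.pderR p q w s) θ := by
      filter_upwards [Ioi_mem_nhds hψ] with s hs using ih hs θ
    exact h1.deriv_eq.trans <| (hw.pderR p q).deriv_comm hψ θ

lemma SmoothPos.hasDerivAt_pderR_left {w : ℝ → ℝ → ℝ} (hw : SmoothPos w) (p q : ℕ) {ψ : ℝ}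
    (hψ : 0 < ψ) (θ : ℝ) :
    HasDerivAt (fun s => _root_.pderR p q w s θ) (_root_.pderR (p+1) q w ψ θ) ψ := by
  rw [pderR_succ_left]
  exact ((hw.pderR p q).hasDerivAt_left hψ θ).differentiableAt.hasDerivAt

lemma SmoothPos.hasDerivAt_pderR_right {w : ℝ → ℝ → ℝ} (hw : SmoothPos w) (p q : ℕ) {ψ : ℝ}
    (hψ : 0 < ψ) (θ : ℝ) :
    HasDerivAt (_root_.pderR p q w ψ) (_root_.pderR p (q+1) w ψ θ) θ := by
  rw [hw.pderR_succ_right p q hψ]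
  exact ((hw.pderR p q).hasDerivAt_right hψ θ).differentiableAt.hasDerivAt

lemma continuous_iteratedDeriv_of_smooth {ξ : ℝ → ℝ} (hξ : ContDiff ℝ (⊤ : ℕ∞) ξ) (a : ℕ) :
    Continuous (iteratedDeriv a ξ) :=
  hξ.continuous_iteratedDeriv a (WithTop.coe_le_coe.2 le_top)

lemma hasDerivAt_iteratedDeriv_of_smooth {ξ : ℝ → ℝ} (hξ : ContDiff ℝ (⊤ : ℕ∞) ξ) (a : ℕ) (θ : ℝ) :
    HasDerivAt (iteratedDeriv a ξ) (iteratedDeriv (a+1) ξ θ) θ := by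
  rw [iteratedDeriv_succ]
  exact (hξ.differentiable_iteratedDeriv a
    (WithTop.coe_lt_coe.2 (ENat.natCast_lt_top a)) θ).hasDerivAt

/-! ### Chain rule expansion of the superposition remainder -/

/-- A factor of a term in the chain rule expansion of `f(ξ+v) - f(ξ)`: either `∂_θ^a ξ`
or `∂_ψ^p ∂_θ^q v`. -/
inductive Letter : Type
  | base (a : ℕ) : Letter
  | pert (p q : ℕ) : Letter

namespace Letter

/-- The total order of differentiation of a factor. -/
def order : Letter → ℕ
  | base a => a
  | pert p q => p + q

/-- The order of differentiation in `ψ` of a factor. -/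
def psiOrder : Letter → ℕ
  | base _ => 0
  | pert p _ => p

/-- Whether a factor is a derivative of `v`. -/
def IsPert : Letter → Prop
  | base _ => False
  | pert _ _ => True

/-- The value of a factor. -/
def val (ξ : ℝ → ℝ) (v : ℝ → ℝ → ℝ) (ψ θ : ℝ) : Letter → ℝ
  | base a => iteratedDeriv a ξ θ
  | pert p q => pderR p q v ψ θ

/-- The `θ`-derivative of a factor, as a list of summands. -/
def derivTheta : Letter → List Letter
  | base a => [base (a+1)]
  | pert p q => [pert p (q+1)]

/-- The `ψ`-derivative of a factor, as a list of summands. -/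
def derivPsi : Letter → List Letter
  | base _ => []
  | pert p q => [pert (p+1) q]

/-- The Leibniz rule for a product of factors. -/
def derivProd (δ : Letter → List Letter) : List Letter → List (List Letter)
  | [] => []
  | x :: l => (δ x).map (fun y => y :: l) ++ (derivProd δ l).map (fun l' => x :: l')

/-- `(d, l)` stands for `f^(k)(u) ∏ l` or `(f^(k)(u) - f^(k)(ξ)) ∏ l`, where `k = l.length`. -/
def termVal (F : ℕ → ℝ → ℝ) (g : Letter → ℝ) (T : Bool × List Letter) : ℝ :=
  (F T.2.length (g (base 0) + g (pert 0 0)) - if T.1 then F T.2.length (g (base 0)) else 0) *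
    (T.2.map g).prod

/-- The derivative of a term, as a list of terms. -/
def derivTerm (δ : Letter → List Letter) (T : Bool × List Letter) : List (Bool × List Letter) :=
  (δ (base 0)).map (fun y => (T.1, y :: T.2)) ++ (δ (pert 0 0)).map (fun y => (false, y :: T.2)) ++
    (derivProd δ T.2).map (fun l => (T.1, l))

/-- The terms that occur in `∂_ψ^p ∂_θ^(n-p) (f(ξ+v) - f(ξ))`. -/
structure IsTerm (n p : ℕ) (T : Bool × List Letter) : Prop where
  length_le : T.2.length ≤ n
  order_eq : (T.2.map order).sum = n
  psiOrder_eq : (T.2.map psiOrder).sum = p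
  exists_pert : T.1 = false → ∃ x ∈ T.2, x.IsPert

lemma sum_map_cons_prod (g : Letter → ℝ) (l : List Letter) (L : List Letter) :
    ((L.map (fun y => y :: l)).map (fun l => (l.map g).prod)).sum =
      (L.map g).sum * (l.map g).prod := by
  induction L with
  | nil => simp
  | cons a L ih => simp only [List.map_cons, List.sum_cons, ih, List.prod_cons]; ring

lemma sum_map_prod_cons (g : Letter → ℝ) (x : Letter) (L : List (List Letter)) :
    ((L.map (fun l => x :: l)).map (fun l => (l.map g).prod)).sum =
      g x * (L.map (fun l => (l.map g).prod)).sum := by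
  induction L with
  | nil => simp
  | cons a L ih => simp only [List.map_cons, List.sum_cons, ih, List.prod_cons]; ring

lemma hasDerivAt_prod {δ : Letter → List Letter} {G : ℝ → Letter → ℝ} {t : ℝ}
    (hG : ∀ x, HasDerivAt (fun s => G s x) ((δ x).map (G t)).sum t) (l : List Letter) :
    HasDerivAt (fun s => (l.map (G s)).prod)
      ((derivProd δ l).map (fun l => (l.map (G t)).prod)).sum t := by
  induction l with
  | nil => simpa [derivProd] using hasDerivAt_const t (1:ℝ)
  | cons x l ih =>
    simp only [List.map_cons, List.prod_cons, derivProd, List.map_append, List.sum_append,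
      sum_map_cons_prod, sum_map_prod_cons]
    exact (hG x).mul ih

lemma length_of_mem_derivProd {δ : Letter → List Letter} {l l' : List Letter}
    (h : l' ∈ derivProd δ l) : l'.length = l.length := by
  induction l generalizing l' with
  | nil => simp [derivProd] at h
  | cons x l ih =>
    simp only [derivProd, List.mem_append, List.mem_map] at h
    rcases h with ⟨y, -, rfl⟩ | ⟨k, hk, rfl⟩
    · simp
    · simp [ih hk]

lemma sum_derivProd_termVal {δ : Letter → List Letter} (F : ℕ → ℝ → ℝ) (g : Letter → ℝ) (d : Bool)
    (l : List Letter) :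
    (((derivProd δ l).map (fun l => (d, l))).map (termVal F g)).sum =
      (F l.length (g (base 0) + g (pert 0 0)) - if d then F l.length (g (base 0)) else 0) *
        ((derivProd δ l).map (fun l => (l.map g).prod)).sum := by
  rw [← List.sum_map_mul_left, List.map_map]
  congr 1
  refine List.map_congr_left fun l' hl' => ?_
  simp [termVal, length_of_mem_derivProd hl']

lemma sum_cons_termVal (F : ℕ → ℝ → ℝ) (g : Letter → ℝ) (d : Bool) (l L : List Letter) :
    ((L.map (fun y => (d, y :: l))).map (termVal F g)).sum =
      (F (l.length + 1) (g (base 0) + g (pert 0 0)) -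
        if d then F (l.length + 1) (g (base 0)) else 0) * (L.map g).sum * (l.map g).prod := by
  induction L with
  | nil => simp
  | cons a L ih =>
    simp only [List.map_cons, List.sum_cons, ih, termVal, List.prod_cons, List.length_cons]
    ring

lemma hasDerivAt_termVal {δ : Letter → List Letter} {F : ℕ → ℝ → ℝ} {G : ℝ → Letter → ℝ} {t : ℝ}
    (hG : ∀ x, HasDerivAt (fun s => G s x) ((δ x).map (G t)).sum t) (T : Bool × List Letter)
    (hF : ∀ x, HasDerivAt (F T.2.length) (F (T.2.length + 1) x) x) :
    HasDerivAt (fun s => termVal F (G s) T) ((derivTerm δ T).map (termVal F (G t))).sum t := by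
  obtain ⟨d, l⟩ := T
  have hu := (hF (G t (base 0) + G t (pert 0 0))).comp t ((hG (base 0)).add (hG (pert 0 0)))
  have hb := (hF (G t (base 0))).comp t (hG (base 0))
  have hp := hasDerivAt_prod hG l
  simp only [derivTerm, List.map_append, List.sum_append, sum_derivProd_termVal, sum_cons_termVal]
  cases d
  · refine ((hu.mul hp).congr_of_eventuallyEq (.of_forall fun s => ?_)).congr_deriv ?_
    · simp [termVal]
    · simp only [Function.comp_apply, Pi.add_apply, Bool.false_eq_true, if_false]
      ring
  · refine (((hu.sub hb).mul hp).congr_of_eventuallyEq (.of_forall fun s => ?_)).congr_deriv ?_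
    · simp [termVal]
    · simp only [Function.comp_apply, Pi.add_apply, Pi.sub_apply, Bool.false_eq_true, if_false, if_true]
      ring

lemma exists_of_mem_derivProd {δ : Letter → List Letter} {e : ℕ}
    (hδ : ∀ x, ∀ y ∈ δ x, y.order = x.order + 1 ∧ y.psiOrder = x.psiOrder + e ∧
      (y.IsPert ↔ x.IsPert))
    {l l' : List Letter} (h : l' ∈ derivProd δ l) :
    (l'.map order).sum = (l.map order).sum + 1 ∧
      (l'.map psiOrder).sum = (l.map psiOrder).sum + e ∧
      ((∃ x ∈ l, x.IsPert) → ∃ x ∈ l', x.IsPert) := by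
  induction l generalizing l' with
  | nil => simp [derivProd] at h
  | cons x l ih =>
    simp only [derivProd, List.mem_append, List.mem_map] at h
    rcases h with ⟨y, hy, rfl⟩ | ⟨k, hk, rfl⟩
    · obtain ⟨h1, h2, h3⟩ := hδ x y hy
      simp only [List.map_cons, List.sum_cons, List.exists_mem_cons_iff, h1, h2, h3]
      exact ⟨by ring, by ring, id⟩
    · obtain ⟨h1, h2, h3⟩ := ih hk
      simp only [List.map_cons, List.sum_cons, List.exists_mem_cons_iff, h1, h2]
      exact ⟨by ring, by ring, Or.imp_right h3⟩

lemma IsTerm.of_mem_derivTerm {δ : Letter → List Letter} {e : ℕ}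
    (hδ : ∀ x, ∀ y ∈ δ x, y.order = x.order + 1 ∧ y.psiOrder = x.psiOrder + e ∧
      (y.IsPert ↔ x.IsPert))
    {n p : ℕ} {T T' : Bool × List Letter} (hT : IsTerm n p T) (h : T' ∈ derivTerm δ T) :
    IsTerm (n+1) (p+e) T' := by
  obtain ⟨h1, h2, h3, h4⟩ := hT
  simp only [derivTerm, List.mem_append, List.mem_map] at h
  rcases h with (⟨y, hy, rfl⟩ | ⟨y, hy, rfl⟩) | ⟨k, hk, rfl⟩
  · obtain ⟨e1, e2, e3⟩ := hδ _ y hy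
    refine ⟨by simpa using h1, ?_, ?_, fun hd => ?_⟩
    · rw [List.map_cons, List.sum_cons, h2, show y.order = 1 from e1, add_comm]
    · rw [List.map_cons, List.sum_cons, h3, show y.psiOrder = e from e2.trans (Nat.zero_add e),
        add_comm]
    · obtain ⟨x, hx, hx'⟩ := h4 hd
      exact ⟨x, List.mem_cons_of_mem _ hx, hx'⟩
  · obtain ⟨e1, e2, e3⟩ := hδ _ y hy
    refine ⟨by simpa using h1, ?_, ?_, fun _ => ⟨y, List.mem_cons_self, e3.2 trivial⟩⟩
    · rw [List.map_cons, List.sum_cons, h2, show y.order = 1 from e1, add_comm]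
    · rw [List.map_cons, List.sum_cons, h3, show y.psiOrder = e from e2.trans (Nat.zero_add e),
        add_comm]
  · obtain ⟨e1, e2, e3⟩ := exists_of_mem_derivProd hδ hk
    exact ⟨by simpa [length_of_mem_derivProd hk] using h1.trans (Nat.le_succ n),
      by simp [e1, h2], by simp [e2, h3], fun hd => e3 (h4 hd)⟩

lemma derivTheta_spec : ∀ x, ∀ y ∈ derivTheta x, y.order = x.order + 1 ∧
    y.psiOrder = x.psiOrder + 0 ∧ (y.IsPert ↔ x.IsPert) := by
  rintro (a | ⟨p, q⟩) y hy
  · obtain rfl := List.mem_singleton.1 hy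
    simp [order, psiOrder, IsPert]
  · obtain rfl := List.mem_singleton.1 hy
    simp [order, psiOrder, IsPert]
    ring

lemma derivPsi_spec : ∀ x, ∀ y ∈ derivPsi x, y.order = x.order + 1 ∧
    y.psiOrder = x.psiOrder + 1 ∧ (y.IsPert ↔ x.IsPert) := by
  rintro (a | ⟨p, q⟩) y hy
  · simp [derivPsi] at hy
  · obtain rfl := List.mem_singleton.1 hy
    simp [order, psiOrder, IsPert]
    ring

lemma hasDerivAt_val_theta {ξ : ℝ → ℝ} (hξ : ContDiff ℝ (⊤ : ℕ∞) ξ) {v : ℝ → ℝ → ℝ}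
    (hv : SmoothPos v) {ψ : ℝ} (hψ : 0 < ψ) (θ : ℝ) (x : Letter) :
    HasDerivAt (fun t => val ξ v ψ t x) ((derivTheta x).map (val ξ v ψ θ)).sum θ := by
  cases x with
  | base a =>
    simpa [derivTheta, val] using hasDerivAt_iteratedDeriv_of_smooth hξ a θ
  | pert p q => simpa [derivTheta, val] using hv.hasDerivAt_pderR_right p q hψ θ

lemma hasDerivAt_val_psi (ξ : ℝ → ℝ) {v : ℝ → ℝ → ℝ}
    (hv : SmoothPos v) {ψ : ℝ} (hψ : 0 < ψ) (θ : ℝ) (x : Letter) :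
    HasDerivAt (fun s => val ξ v s θ x) ((derivPsi x).map (val ξ v ψ θ)).sum ψ := by
  cases x with
  | base a => simpa [derivPsi, val] using hasDerivAt_const ψ _
  | pert p q => simpa [derivPsi, val] using hv.hasDerivAt_pderR_left p q hψ θ

lemma hasDerivAt_sum_termVal {δ : Letter → List Letter} {F : ℕ → ℝ → ℝ} {G : ℝ → Letter → ℝ}
    {t : ℝ} (hG : ∀ x, HasDerivAt (fun s => G s x) ((δ x).map (G t)).sum t)
    (L : List (Bool × List Letter))
    (hF : ∀ T ∈ L, ∀ x, HasDerivAt (F T.2.length) (F (T.2.length + 1) x) x) :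
    HasDerivAt (fun s => (L.map (termVal F (G s))).sum)
      ((L.flatMap (derivTerm δ)).map (termVal F (G t))).sum t := by
  induction L with
  | nil => simpa using hasDerivAt_const t (0:ℝ)
  | cons T L ih =>
    simp only [List.map_cons, List.sum_cons, List.flatMap_cons, List.map_append, List.sum_append]
    exact (hasDerivAt_termVal hG T (hF T (by simp))).add
      (ih fun T hT => hF T (List.mem_cons_of_mem _ hT))

/-- Every derivative of `f(ξ+v) - f(ξ)` is a sum of terms from a list that does not depend on
`f`, `ξ`, `v`. -/
lemma exists_expansion (p q : ℕ) : ∃ L : List (Bool × List Letter),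
    (∀ T ∈ L, IsTerm (p+q) p T) ∧
    ∀ f : ℝ → ℝ,
      (∀ k < p + q, ∀ x, HasDerivAt (iteratedDeriv k f) (iteratedDeriv (k+1) f x) x) →
      ∀ ξ : ℝ → ℝ, ContDiff ℝ (⊤ : ℕ∞) ξ → ∀ v : ℝ → ℝ → ℝ, SmoothPos v →
      ∀ ψ > 0, ∀ θ, pderR p q (fun ψ θ => f (ξ θ + v ψ θ) - f (ξ θ)) ψ θ =
        (L.map (termVal (fun k => iteratedDeriv k f) (val ξ v ψ θ))).sum := by
  induction p with
  | zero =>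
    induction q with
    | zero =>
      refine ⟨[(true, [])], ?_, fun f _ ξ _ v _ ψ _ θ => ?_⟩
      · simp only [List.mem_singleton, forall_eq]
        exact ⟨by simp, by simp, by simp, by simp⟩
      · rw [pderR_zero_zero]
        simp [termVal, val, pderR]
    | succ q ih =>
      obtain ⟨L, hL, hexp⟩ := ih
      refine ⟨L.flatMap (derivTerm derivTheta), fun T hT => ?_, fun f hf ξ hξ v hv ψ hψ θ => ?_⟩
      · obtain ⟨T', hT', h⟩ := List.mem_flatMap.1 hT
        exact (hL T' hT').of_mem_derivTerm derivTheta_spec h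
      · rw [pderR_zero_succ]
        have h : pderR 0 q (fun ψ θ => f (ξ θ + v ψ θ) - f (ξ θ)) ψ = fun t =>
            (L.map (termVal (fun k => iteratedDeriv k f) (val ξ v ψ t))).sum :=
          funext fun t => hexp f (fun k hk => hf k (by omega)) ξ hξ v hv ψ hψ t
        simp only [h]
        exact (hasDerivAt_sum_termVal (F := fun k => iteratedDeriv k f)
          (hasDerivAt_val_theta hξ hv hψ θ) L
          fun T hT => hf _ (Nat.lt_succ_of_le (hL T hT).length_le)).deriv
  | succ p ih =>
    obtain ⟨L, hL, hexp⟩ := ih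
    refine ⟨L.flatMap (derivTerm derivPsi), fun T hT => ?_, fun f hf ξ hξ v hv ψ hψ θ => ?_⟩
    · obtain ⟨T', hT', h⟩ := List.mem_flatMap.1 hT
      rw [Nat.add_right_comm]
      exact (hL T' hT').of_mem_derivTerm derivPsi_spec h
    · rw [pderR_succ_left]
      have h : (fun s => pderR p q (fun ψ θ => f (ξ θ + v ψ θ) - f (ξ θ)) s θ) =ᶠ[nhds ψ] fun s =>
          (L.map (termVal (fun k => iteratedDeriv k f) (val ξ v s θ))).sum := by
        filter_upwards [Ioi_mem_nhds hψ] with s hs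
        exact hexp f (fun k hk => hf k (by omega)) ξ hξ v hv s hs θ
      refine h.deriv_eq.trans ?_
      exact (hasDerivAt_sum_termVal (F := fun k => iteratedDeriv k f)
        (hasDerivAt_val_psi ξ hv hψ θ) L
        fun T hT => hf _ (by have := (hL T hT).length_le; omega)).deriv

end Letter

/-! ### One-dimensional Sobolev inequalities -/

lemma ofReal_sq_le_lintegral_add {a b : ℝ} (hab : 1 ≤ b - a) {k k' : ℝ → ℝ}
    (hk : ∀ x > a, HasDerivAt k (k' x) x) (hk' : ContinuousOn k' (Ioi a)) {x : ℝ}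
    (hx : x ∈ Ioc a b) :
    ENNReal.ofReal (k x ^ 2) ≤
      (∫⁻ y in Ioc a b, ENNReal.ofReal (k y ^ 2)) +
        ∫⁻ y in Ioc a b, ENNReal.ofReal (2 * |k y * k' y|) := by
  set R := ∫⁻ y in Ioc a b, ENNReal.ofReal (2 * |k y * k' y|) with hR
  have hkc : ContinuousOn k (Ioi a) := fun y hy => (hk y hy).continuousAt.continuousWithinAt
  have key : ∀ y ∈ Ioc a b, ENNReal.ofReal (k x ^ 2) ≤ ENNReal.ofReal (k y ^ 2) + R := by
    intro y hy
    have hsub : uIcc y x ⊆ Ioi a := fun t ht => lt_of_lt_of_le (lt_min hy.1 hx.1) ht.1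
    have hsub' : uIoc y x ⊆ Ioc a b := fun t ht =>
      ⟨(lt_min hy.1 hx.1).trans ht.1, ht.2.trans (max_le hy.2 hx.2)⟩
    have hd : ∀ t ∈ uIcc y x, HasDerivAt (fun t => k t ^ 2) (2 * (k t * k' t)) t := by
      intro t ht
      refine ((hk t (hsub ht)).pow 2).congr_deriv ?_
      simp; ring
    have hint : IntervalIntegrable (fun t => 2 * (k t * k' t)) volume y x :=
      ((continuousOn_const.mul (hkc.mul hk')).mono hsub).intervalIntegrable
    have hftc := intervalIntegral.integral_eq_sub_of_hasDerivAt hd hint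
    have h1 : k x ^ 2 ≤ k y ^ 2 + |∫ t in y..x, 2 * (k t * k' t)| := by
      rw [hftc]; linarith [le_abs_self (k x ^ 2 - k y ^ 2)]
    refine (ENNReal.ofReal_le_ofReal h1).trans ?_
    rw [ENNReal.ofReal_add (sq_nonneg _) (abs_nonneg _)]
    refine add_le_add le_rfl ?_
    rw [intervalIntegral.abs_integral_eq_abs_integral_uIoc, ← Real.norm_eq_abs, ofReal_norm]
    refine (enorm_integral_le_lintegral_enorm _).trans ((lintegral_mono_set hsub').trans ?_)
    refine lintegral_mono fun t => ?_
    rw [← ofReal_norm, Real.norm_eq_abs, abs_mul, abs_two]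
  calc ENNReal.ofReal (k x ^ 2) = ∫⁻ _ in Ioc a (a+1), ENNReal.ofReal (k x ^ 2) := by
        simp
    _ ≤ ∫⁻ y in Ioc a (a+1), (ENNReal.ofReal (k y ^ 2) + R) :=
        setLIntegral_mono' measurableSet_Ioc fun y hy => key y ⟨hy.1, hy.2.trans (by linarith)⟩
    _ = (∫⁻ y in Ioc a (a+1), ENNReal.ofReal (k y ^ 2)) + R := by
        rw [lintegral_add_right _ measurable_const]; simp
    _ ≤ _ := add_le_add (lintegral_mono_set (Ioc_subset_Ioc_right (by linarith))) le_rfl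

lemma ofReal_sq_le_two_mul_lintegral {a b : ℝ} (hab : 1 ≤ b - a) {k k' : ℝ → ℝ}
    (hk : ∀ x > a, HasDerivAt k (k' x) x) (hk' : ContinuousOn k' (Ioi a)) {x : ℝ}
    (hx : x ∈ Ioc a b) :
    ENNReal.ofReal (k x ^ 2) ≤
      2 * ((∫⁻ y in Ioc a b, ENNReal.ofReal (k y ^ 2)) +
        ∫⁻ y in Ioc a b, ENNReal.ofReal (k' y ^ 2)) := by
  have hkc : ContinuousOn k (Ioi a) := fun y hy => (hk y hy).continuousAt.continuousWithinAt
  have hm : AEMeasurable (fun y => ENNReal.ofReal (k y ^ 2)) (volume.restrict (Ioc a b)) :=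
    (((hkc.mono fun y hy => hy.1).pow 2).aemeasurable measurableSet_Ioc).ennreal_ofReal
  have h2 : ∫⁻ y in Ioc a b, ENNReal.ofReal (2 * |k y * k' y|) ≤
      (∫⁻ y in Ioc a b, ENNReal.ofReal (k y ^ 2)) +
        ∫⁻ y in Ioc a b, ENNReal.ofReal (k' y ^ 2) := by
    rw [← lintegral_add_left' hm]
    refine lintegral_mono fun y => ?_
    rw [← ENNReal.ofReal_add (sq_nonneg _) (sq_nonneg _)]
    refine ENNReal.ofReal_le_ofReal ?_
    rw [abs_mul, ← sq_abs (k y), ← sq_abs (k' y)]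
    nlinarith [sq_nonneg (|k y| - |k' y|)]
  refine (ofReal_sq_le_lintegral_add hab hk hk' hx).trans ?_
  rw [two_mul]
  exact add_le_add le_self_add h2

lemma weighted_sq_add_le {γ : ℝ} (hγ : 1/2 < γ) (p : ℕ) {s : ℝ} (hs : s ∈ Ioc (0:ℝ) 1) (h h' : ℝ) :
    (s ^ p * h) ^ 2 + 2 * |s ^ p * h * (p * s ^ (p - 1) * h + s ^ p * h')| ≤
      (2 * p + 2) * (s ^ (2*((p:ℝ) - γ)) * |h| ^ 2 + s ^ (2*(((p+1 : ℕ):ℝ) - γ)) * |h'| ^ 2) := by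
  obtain ⟨h0, h1⟩ := hs
  have e1 : s ^ p * |h| = s ^ γ * (s ^ ((p:ℝ) - γ) * |h|) := by
    rw [← mul_assoc, ← Real.rpow_add h0, ← Real.rpow_natCast]; congr 2; ring
  have e2 : s ^ p * |h'| = s ^ (γ - 1) * (s ^ (((p+1 : ℕ):ℝ) - γ) * |h'|) := by
    rw [← mul_assoc, ← Real.rpow_add h0, ← Real.rpow_natCast]; congr 2; push_cast; ring
  have e3 : p * s ^ (p - 1) * |h| = s ^ (γ - 1) * (p * (s ^ ((p:ℝ) - γ) * |h|)) := by
    rcases Nat.eq_zero_or_pos p with rfl | hp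
    · simp
    · rw [← Real.rpow_natCast, Nat.cast_sub hp,
        show ((p:ℝ) - (1:ℕ)) = (γ - 1) + ((p:ℝ) - γ) by push_cast; ring, Real.rpow_add h0]
      ring
  have f1 : s ^ (2*((p:ℝ) - γ)) * |h| ^ 2 = (s ^ ((p:ℝ) - γ) * |h|) ^ 2 := by
    rw [mul_pow, mul_comm (2:ℝ), Real.rpow_mul h0.le, Real.rpow_two]
  have f2 : s ^ (2*(((p+1 : ℕ):ℝ) - γ)) * |h'| ^ 2 = (s ^ (((p+1 : ℕ):ℝ) - γ) * |h'|) ^ 2 := by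
    rw [mul_pow, mul_comm (2:ℝ), Real.rpow_mul h0.le, Real.rpow_two]
  rw [f1, f2]
  have hr : s ^ γ ≤ 1 := Real.rpow_le_one h0.le h1 (by linarith)
  have hrs : s ^ γ * s ^ (γ - 1) ≤ 1 := by
    rw [← Real.rpow_add h0]; exact Real.rpow_le_one h0.le h1 (by linarith)
  have hr0 : 0 < s ^ γ := Real.rpow_pos_of_pos h0 _
  have hσ0 : 0 < s ^ (γ - 1) := Real.rpow_pos_of_pos h0 _
  have ha : 0 ≤ s ^ ((p:ℝ) - γ) * |h| := by positivity
  have hb : 0 ≤ s ^ (((p+1 : ℕ):ℝ) - γ) * |h'| := by positivity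
  generalize s ^ ((p:ℝ) - γ) * |h| = a at *
  generalize s ^ (((p+1 : ℕ):ℝ) - γ) * |h'| = b at *
  have g1 : (s ^ p * h) ^ 2 ≤ a ^ 2 := by
    rw [← sq_abs, abs_mul, abs_of_pos (pow_pos h0 p), e1]
    exact pow_le_pow_left₀ (by positivity) (mul_le_of_le_one_left ha hr) 2
  have g2 : |s ^ p * h * (p * s ^ (p - 1) * h + s ^ p * h')| ≤ a * (p * a + b) := by
    rw [abs_mul, abs_mul, abs_of_pos (pow_pos h0 p), e1]
    have : |p * s ^ (p - 1) * h + s ^ p * h'| ≤ s ^ (γ - 1) * (p * a + b) := by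
      refine (abs_add_le _ _).trans ?_
      rw [abs_mul, abs_mul (s ^ p), abs_of_pos (pow_pos h0 p), e2,
        abs_of_nonneg (by positivity : (0:ℝ) ≤ p * s ^ (p - 1)), e3, mul_add]
    calc s ^ γ * a * |p * s ^ (p - 1) * h + s ^ p * h'|
        ≤ s ^ γ * a * (s ^ (γ - 1) * (p * a + b)) := by gcongr
      _ = (s ^ γ * s ^ (γ - 1)) * (a * (p * a + b)) := by ring
      _ ≤ a * (p * a + b) := mul_le_of_le_one_left (by positivity) hrs
  have hp0 : (0:ℝ) ≤ p := p.cast_nonneg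
  nlinarith [sq_nonneg (a - b), mul_nonneg hp0 (sq_nonneg b)]

lemma ofReal_weighted_sq_le_lintegral {γ : ℝ} (hγ : 1/2 < γ) (p : ℕ) {h h' : ℝ → ℝ}
    (hh : ∀ x > 0, HasDerivAt h (h' x) x) (hh' : ContinuousOn h' (Ioi 0)) {x : ℝ}
    (hx : x ∈ Ioc (0:ℝ) 1) :
    ENNReal.ofReal ((x ^ p * h x) ^ 2) ≤ (2 * p + 2) *
      ∫⁻ s in Ioc (0:ℝ) 1, (ENNReal.ofReal (s ^ (2*((p:ℝ) - γ)) * |h s| ^ 2) +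
        ENNReal.ofReal (s ^ (2*(((p+1 : ℕ):ℝ) - γ)) * |h' s| ^ 2)) := by
  have hhc : ContinuousOn h (Ioi 0) := fun y hy => (hh y hy).continuousAt.continuousWithinAt
  have h1 := ofReal_sq_le_lintegral_add (a := 0) (b := 1) (by norm_num)
    (k := fun s => s ^ p * h s) (k' := fun s => p * s ^ (p - 1) * h s + s ^ p * h' s)
    (fun s hs => (hasDerivAt_pow p s).mul (hh s hs)) (by fun_prop) hx
  refine h1.trans ((le_lintegral_add _ _).trans ?_)
  have hc : (2 * (p:ℝ≥0∞) + 2) = ENNReal.ofReal (2 * p + 2) := by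
    rw [ENNReal.ofReal_add (by positivity) (by norm_num), ENNReal.ofReal_mul (by norm_num)]
    simp
  rw [hc, ← lintegral_const_mul' _ _ ENNReal.ofReal_ne_top]
  refine setLIntegral_mono' measurableSet_Ioc fun s hs => ?_
  have hs0 := hs.1
  rw [← ENNReal.ofReal_add (by positivity) (by positivity),
    ← ENNReal.ofReal_add (by positivity) (by positivity), ← ENNReal.ofReal_mul (by positivity)]
  exact ENNReal.ofReal_le_ofReal (weighted_sq_add_le hγ p hs (h s) (h' s))

/-! ### Mixed-norm bounds for the derivatives of `v` -/

/-- The integrand in the Kondratev norm. -/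
def kondratevDensity (γ : ℝ) (v : ℝ → ℝ → ℝ) (p q : ℕ) (ψ θ : ℝ) : ℝ≥0∞ :=
  ENNReal.ofReal (ψ ^ (2*((p:ℝ) - γ)) * |pderR p q v ψ θ|^2)

/-- The integrand in the Kondratev norm, integrated over the circle. -/
def kondratevSlice (γ : ℝ) (v : ℝ → ℝ → ℝ) (p q : ℕ) (ψ : ℝ) : ℝ≥0∞ :=
  ∫⁻ θ in Ioc (0:ℝ) (2*π), kondratevDensity γ v p q ψ θ

lemma lintegral_kondratevSlice_le (γ : ℝ) {m : ℕ} (v : ℝ → ℝ → ℝ) {p q : ℕ} (h : p + q ≤ m) :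
    ∫⁻ ψ in Ioc (0:ℝ) 1, kondratevSlice γ v p q ψ ≤ KNormSqR γ m v := by
  refine le_trans ?_ (Finset.single_le_sum
    (f := fun p => ∑ q ∈ Finset.range (m+1-p),
      ∫⁻ ψ in Ioc (0:ℝ) 1, ∫⁻ θ in Ioc (0:ℝ) (2*π),
      ENNReal.ofReal (ψ ^ (2*((p:ℝ) - γ)) * |pderR p q v ψ θ|^2))
    (fun _ _ => zero_le) (Finset.mem_range.2 (by omega : p < m + 1)))
  exact Finset.single_le_sum
    (f := fun q => ∫⁻ ψ in Ioc (0:ℝ) 1, ∫⁻ θ in Ioc (0:ℝ) (2*π),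
      ENNReal.ofReal (ψ ^ (2*((p:ℝ) - γ)) * |pderR p q v ψ θ|^2))
    (fun _ _ => zero_le) (Finset.mem_range.2 (by omega : q < m + 1 - p))

lemma aemeasurable_annulus {F : ℝ × ℝ → ℝ} (hF : ContinuousOn F (Ioi (0:ℝ) ×ˢ (univ : Set ℝ))) :
    AEMeasurable F ((volume.restrict (Ioc (0:ℝ) 1)).prod (volume.restrict (Ioc (0:ℝ) (2*π)))) := by
  rw [Measure.prod_restrict]
  exact (hF.mono (prod_mono (fun y hy => hy.1) (subset_univ _))).aemeasurable
    (measurableSet_Ioc.prod measurableSet_Ioc)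

lemma continuousOn_rpow_fst (r : ℝ) :
    ContinuousOn (fun z : ℝ × ℝ => z.1 ^ r) (Ioi (0:ℝ) ×ˢ (univ : Set ℝ)) :=
  continuousOn_fst.rpow_const fun _ hz => Or.inl (ne_of_gt hz.1)

section Density

variable {γ : ℝ} {v : ℝ → ℝ → ℝ}

lemma aemeasurable_kondratevDensity (hv : SmoothPos v) (p q : ℕ) :
    AEMeasurable (Function.uncurry (kondratevDensity γ v p q))
      ((volume.restrict (Ioc (0:ℝ) 1)).prod (volume.restrict (Ioc (0:ℝ) (2*π)))) :=
  (aemeasurable_annulus ((continuousOn_rpow_fst _).mul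
    ((hv.pderR p q).continuousOn.abs.pow 2))).ennreal_ofReal

lemma aemeasurable_kondratevSlice (hv : SmoothPos v) (p q : ℕ) :
    AEMeasurable (kondratevSlice γ v p q) (volume.restrict (Ioc (0:ℝ) 1)) :=
  (aemeasurable_kondratevDensity hv p q).lintegral_prod_right'

lemma continuous_pderR (hv : SmoothPos v) (p q : ℕ) {ψ : ℝ} (hψ : 0 < ψ) :
    Continuous (pderR p q v ψ) :=
  continuous_iff_continuousAt.2 fun θ => (hv.hasDerivAt_pderR_right p q hψ θ).continuousAt

lemma measurable_kondratevDensity (hv : SmoothPos v) (p q : ℕ) {ψ : ℝ} (hψ : 0 < ψ) :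
    Measurable (kondratevDensity γ v p q ψ) :=
  (((continuous_pderR hv p q hψ).abs.pow 2).const_mul _).measurable.ennreal_ofReal

lemma one_le_two_pi_sub_zero : (1:ℝ) ≤ 2 * π - 0 := by linarith [Real.pi_gt_three]

lemma kondratevDensity_le_slice (hv : SmoothPos v) (p q : ℕ) {ψ : ℝ} (hψ : 0 < ψ) {θ : ℝ}
    (hθ : θ ∈ Ioc 0 (2*π)) :
    kondratevDensity γ v p q ψ θ ≤
      2 * (kondratevSlice γ v p q ψ + kondratevSlice γ v p (q+1) ψ) := by
  have key : ∀ q t, ψ ^ (2*((p:ℝ) - γ)) * |pderR p q v ψ t|^2 =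
      (ψ ^ ((p:ℝ) - γ) * pderR p q v ψ t) ^ 2 := by
    intro q t
    rw [mul_pow, mul_comm (2:ℝ), Real.rpow_mul hψ.le, Real.rpow_two, sq_abs]
  simp only [kondratevSlice, kondratevDensity, key]
  exact ofReal_sq_le_two_mul_lintegral one_le_two_pi_sub_zero
    (fun t _ => (hv.hasDerivAt_pderR_right p q hψ t).const_mul _)
    ((continuous_pderR hv p (q+1) hψ).const_mul _).continuousOn hθ

lemma ofReal_pderR_sq_le (hγ : 1/2 < γ) (hv : SmoothPos v) (p q : ℕ) {ψ : ℝ}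
    (hψ : ψ ∈ Ioc (0:ℝ) 1) (θ : ℝ) :
    ENNReal.ofReal ((ψ ^ p * pderR p q v ψ θ) ^ 2) ≤ (2 * p + 2) *
      ∫⁻ s in Ioc (0:ℝ) 1, (kondratevDensity γ v p q s θ + kondratevDensity γ v (p+1) q s θ) :=
  ofReal_weighted_sq_le_lintegral hγ p (h := fun s => pderR p q v s θ)
    (h' := fun s => pderR (p+1) q v s θ) (fun _ hs => hv.hasDerivAt_pderR_left p q hs θ)
    (fun _ hs => (hv.hasDerivAt_pderR_left (p+1) q hs θ).continuousAt.continuousWithinAt) hψ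

lemma two_mul_add_two_le {p m : ℕ} (h : p ≤ m) (k : ℕ) (hk : k ≤ 8) (x : ℝ≥0∞) :
    (2 * p + 2) * (k * x) ≤ 16 * (m + 1) * x := by
  rw [← mul_assoc]
  have h' : (2 * p + 2) * k ≤ 16 * (m + 1) := by nlinarith
  exact mul_le_mul' (by exact_mod_cast h') le_rfl

lemma lintegral_slices_le (hv : SmoothPos v) {m p q p' q' : ℕ} (h : p + q ≤ m) (h' : p' + q' ≤ m) :
    ∫⁻ s in Ioc (0:ℝ) 1, (kondratevSlice γ v p q s + kondratevSlice γ v p' q' s) ≤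
      2 * KNormSqR γ m v := by
  rw [lintegral_add_left' (aemeasurable_kondratevSlice hv p q), two_mul]
  exact add_le_add (lintegral_kondratevSlice_le γ v h) (lintegral_kondratevSlice_le γ v h')

lemma ofReal_pderR_sq_le_KNormSqR (hγ : 1/2 < γ) (hv : SmoothPos v) {m p q : ℕ}
    (hpq : p + q + 2 ≤ m) {ψ θ : ℝ} (hψ : ψ ∈ Ioc (0:ℝ) 1) (hθ : θ ∈ Ioc 0 (2*π)) :
    ENNReal.ofReal ((ψ ^ p * pderR p q v ψ θ) ^ 2) ≤ 16 * (m + 1) * KNormSqR γ m v := by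
  refine (ofReal_pderR_sq_le hγ hv p q hψ θ).trans (le_trans ?_
    (two_mul_add_two_le (by omega : p ≤ m) 8 le_rfl _))
  gcongr
  calc ∫⁻ s in Ioc (0:ℝ) 1, (kondratevDensity γ v p q s θ + kondratevDensity γ v (p+1) q s θ)
      ≤ ∫⁻ s in Ioc (0:ℝ) 1, 2 * ((kondratevSlice γ v p q s + kondratevSlice γ v p (q+1) s) +
          (kondratevSlice γ v (p+1) q s + kondratevSlice γ v (p+1) (q+1) s)) := by
        refine setLIntegral_mono' measurableSet_Ioc fun s hs => ?_
        rw [mul_add]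
        exact add_le_add (kondratevDensity_le_slice hv p q hs.1 hθ)
          (kondratevDensity_le_slice hv (p+1) q hs.1 hθ)
    _ ≤ 2 * (2 * KNormSqR γ m v + 2 * KNormSqR γ m v) := by
        rw [lintegral_const_mul' _ _ (by simp), lintegral_add_left'
          (f := fun s => kondratevSlice γ v p q s + kondratevSlice γ v p (q+1) s)
          ((aemeasurable_kondratevSlice hv p q).add (aemeasurable_kondratevSlice hv p (q+1)))]
        gcongr
        · exact lintegral_slices_le hv (by omega) (by omega)
        · exact lintegral_slices_le hv (by omega) (by omega)
    _ = (8:ℕ) * KNormSqR γ m v := by push_cast; ring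

lemma lintegral_ofReal_pderR_sq_le_KNormSqR (hγ : 1/2 < γ) (hv : SmoothPos v) {m p q : ℕ}
    (hpq : p + q + 1 ≤ m) {ψ : ℝ} (hψ : ψ ∈ Ioc (0:ℝ) 1) :
    ∫⁻ θ in Ioc (0:ℝ) (2*π), ENNReal.ofReal ((ψ ^ p * pderR p q v ψ θ) ^ 2) ≤
      16 * (m + 1) * KNormSqR γ m v := by
  refine (lintegral_mono fun θ => ofReal_pderR_sq_le hγ hv p q hψ θ).trans (le_trans ?_
    (two_mul_add_two_le (by omega : p ≤ m) 2 (by norm_num) _))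
  rw [lintegral_const_mul' _ _ (by finiteness)]
  gcongr
  rw [lintegral_lintegral_swap]
  · refine le_trans (le_of_eq (setLIntegral_congr_fun measurableSet_Ioc fun s hs => ?_))
      (lintegral_slices_le (p := p) (q := q) (p' := p+1) (q' := q) hv (by omega) (by omega))
    exact lintegral_add_left (measurable_kondratevDensity hv p q hs.1) _
  · exact ((aemeasurable_kondratevDensity hv p q).add
      (aemeasurable_kondratevDensity hv (p+1) q)).prod_swap

end Density

/-! ### Product estimates -/

lemma HNormR_sq (m : ℕ) (ξ : ℝ → ℝ) : HNormR m ξ ^ 2 = ∑ q ∈ Finset.range (m+1),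
    ∫⁻ θ in Ioc (0:ℝ) (2*π), ENNReal.ofReal (|iteratedDeriv q ξ θ|^2) := by
  rw [HNormR, ← ENNReal.rpow_natCast, ← ENNReal.rpow_mul]
  norm_num

lemma KNormR_sq (γ : ℝ) (m : ℕ) (w : ℝ → ℝ → ℝ) : KNormR γ m w ^ 2 = KNormSqR γ m w := by
  rw [KNormR, ← ENNReal.rpow_natCast, ← ENNReal.rpow_mul]
  norm_num

lemma lintegral_iteratedDeriv_sq_le {m a : ℕ} (ha : a ≤ m) (ξ : ℝ → ℝ) :
    ∫⁻ θ in Ioc (0:ℝ) (2*π), ENNReal.ofReal (iteratedDeriv a ξ θ ^ 2) ≤ HNormR m ξ ^ 2 := by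
  rw [HNormR_sq]
  simp only [sq_abs]
  exact Finset.single_le_sum
    (f := fun q => ∫⁻ θ in Ioc (0:ℝ) (2*π), ENNReal.ofReal (iteratedDeriv q ξ θ ^ 2))
    (fun _ _ => zero_le) (Finset.mem_range.2 (by omega))

lemma HNormR_ne_top {ξ : ℝ → ℝ} (hξ : ContDiff ℝ (⊤ : ℕ∞) ξ) (m : ℕ) : HNormR m ξ ≠ ⊤ := by
  have h : HNormR m ξ ^ 2 ≠ ⊤ := by
    rw [HNormR_sq]
    refine ENNReal.sum_ne_top.2 fun q _ => ?_
    exact (((continuous_iteratedDeriv_of_smooth hξ q).abs.pow 2).integrableOn_Ioc).lintegral_lt_top.ne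
  exact fun h' => h (by simp [h'])

lemma ofReal_iteratedDeriv_sq_le {ξ : ℝ → ℝ} (hξ : ContDiff ℝ (⊤ : ℕ∞) ξ) {m a : ℕ}
    (ha : a + 1 ≤ m) {θ : ℝ} (hθ : θ ∈ Ioc 0 (2*π)) :
    ENNReal.ofReal (iteratedDeriv a ξ θ ^ 2) ≤ 4 * HNormR m ξ ^ 2 := by
  refine (ofReal_sq_le_two_mul_lintegral one_le_two_pi_sub_zero
    (fun t _ => hasDerivAt_iteratedDeriv_of_smooth hξ a t)
    (continuous_iteratedDeriv_of_smooth hξ (a+1)).continuousOn hθ).trans ?_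
  calc _ ≤ 2 * (HNormR m ξ ^ 2 + HNormR m ξ ^ 2) := by
        gcongr
        · exact lintegral_iteratedDeriv_sq_le (by omega) ξ
        · exact lintegral_iteratedDeriv_sq_le ha ξ
    _ = _ := by ring

namespace Letter

/-- The square of a factor, weighted by its power of `ψ`. -/
def density (ξ : ℝ → ℝ) (v : ℝ → ℝ → ℝ) (ψ θ : ℝ) (x : Letter) : ℝ≥0∞ :=
  ENNReal.ofReal ((ψ ^ x.psiOrder * val ξ v ψ θ x) ^ 2)

/-- The integrand in the Kondratev norm of a product of factors. -/
def prodDensity (γ : ℝ) (ξ : ℝ → ℝ) (v : ℝ → ℝ → ℝ) (l : List Letter) (ψ θ : ℝ) : ℝ≥0∞ :=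
  ENNReal.ofReal (ψ ^ (2*(((l.map psiOrder).sum : ℝ) - γ)) * |(l.map (val ξ v ψ θ)).prod| ^ 2)

/-- The common bound for the factors. -/
def bound (γ : ℝ) (m : ℕ) (ξ : ℝ → ℝ) (v : ℝ → ℝ → ℝ) : ℝ≥0∞ :=
  16 * (m + 1) * (HNormR m ξ + KNormR γ m v) ^ 2

/-- Factors that are pointwise bounded by Sobolev embedding. -/
def IsBounded (m : ℕ) : Letter → Prop
  | base a => a + 1 ≤ m
  | pert p q => p + q + 2 ≤ m

/-- Factors that are bounded in `L^∞_ψ L^2_θ`. -/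
def IsSliceBounded (m : ℕ) : Letter → Prop
  | base a => a ≤ m
  | pert p q => p + q + 1 ≤ m

section Estimates

variable {γ : ℝ} {m : ℕ} {ξ : ℝ → ℝ} {v : ℝ → ℝ → ℝ}

lemma mul_HNormR_sq_le_bound (γ : ℝ) (m : ℕ) (ξ : ℝ → ℝ) (v : ℝ → ℝ → ℝ) :
    4 * HNormR m ξ ^ 2 ≤ bound γ m ξ v := by
  refine mul_le_mul' ?_ (pow_le_pow_left' le_self_add 2)
  exact_mod_cast (by omega : 4 ≤ 16 * (m + 1))

lemma mul_KNormSqR_le_bound (γ : ℝ) (m : ℕ) (ξ : ℝ → ℝ) (v : ℝ → ℝ → ℝ) :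
    16 * (m + 1) * KNormSqR γ m v ≤ bound γ m ξ v := by
  rw [← KNormR_sq]
  exact mul_le_mul' le_rfl (pow_le_pow_left' le_add_self 2)

lemma four_mul_KNormSqR_le_bound (γ : ℝ) (m : ℕ) (ξ : ℝ → ℝ) (v : ℝ → ℝ → ℝ) :
    4 * KNormSqR γ m v ≤ bound γ m ξ v := by
  refine le_trans (mul_le_mul' ?_ le_rfl) (mul_KNormSqR_le_bound γ m ξ v)
  exact_mod_cast (by omega : 4 ≤ 16 * (m + 1))

lemma bound_ne_top (hξ : ContDiff ℝ (⊤ : ℕ∞) ξ) (hv : KNormR γ m v ≠ ⊤) :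
    bound γ m ξ v ≠ ⊤ := by
  have := HNormR_ne_top hξ m
  unfold bound
  finiteness

lemma density_le_bound (hγ : 1/2 < γ) (hξ : ContDiff ℝ (⊤ : ℕ∞) ξ) (hv : SmoothPos v) {x : Letter}
    (hx : x.IsBounded m) {ψ θ : ℝ} (hψ : ψ ∈ Ioc (0:ℝ) 1) (hθ : θ ∈ Ioc 0 (2*π)) :
    density ξ v ψ θ x ≤ bound γ m ξ v := by
  cases x with
  | base a =>
    simp only [density, psiOrder, val, pow_zero, one_mul]
    exact (ofReal_iteratedDeriv_sq_le hξ hx hθ).trans (mul_HNormR_sq_le_bound γ m ξ v)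
  | pert p q =>
    exact (ofReal_pderR_sq_le_KNormSqR hγ hv hx hψ hθ).trans (mul_KNormSqR_le_bound γ m ξ v)

lemma lintegral_density_le_bound (hγ : 1/2 < γ) (hv : SmoothPos v) {x : Letter}
    (hx : x.IsSliceBounded m) {ψ : ℝ} (hψ : ψ ∈ Ioc (0:ℝ) 1) :
    ∫⁻ θ in Ioc (0:ℝ) (2*π), density ξ v ψ θ x ≤ bound γ m ξ v := by
  cases x with
  | base a =>
    simp only [density, psiOrder, val, pow_zero, one_mul]
    refine (lintegral_iteratedDeriv_sq_le hx ξ).trans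
      (le_trans ?_ (mul_HNormR_sq_le_bound γ m ξ v))
    exact le_mul_of_one_le_left' (by norm_num)
  | pert p q =>
    exact (lintegral_ofReal_pderR_sq_le_KNormSqR hγ hv hx hψ).trans
      (mul_KNormSqR_le_bound γ m ξ v)

lemma continuous_val (hξ : ContDiff ℝ (⊤ : ℕ∞) ξ) (hv : SmoothPos v) {ψ : ℝ} (hψ : 0 < ψ)
    (x : Letter) : Continuous (fun θ => val ξ v ψ θ x) := by
  cases x with
  | base a => exact continuous_iteratedDeriv_of_smooth hξ a
  | pert p q => exact continuous_pderR hv p q hψ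

lemma continuousOn_val (hξ : ContDiff ℝ (⊤ : ℕ∞) ξ) (hv : SmoothPos v) (x : Letter) :
    ContinuousOn (fun z : ℝ × ℝ => val ξ v z.1 z.2 x) (Ioi (0:ℝ) ×ˢ (univ : Set ℝ)) := by
  cases x with
  | base a => exact ((continuous_iteratedDeriv_of_smooth hξ a).comp continuous_snd).continuousOn
  | pert p q => exact (hv.pderR p q).continuousOn

lemma measurable_density (hξ : ContDiff ℝ (⊤ : ℕ∞) ξ) (hv : SmoothPos v) {ψ : ℝ} (hψ : 0 < ψ)
    (x : Letter) : Measurable (fun θ => density ξ v ψ θ x) :=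
  (((continuous_val hξ hv hψ x).const_mul _).pow 2).measurable.ennreal_ofReal

lemma measurable_prodDensity (hξ : ContDiff ℝ (⊤ : ℕ∞) ξ) (hv : SmoothPos v) {ψ : ℝ} (hψ : 0 < ψ)
    (l : List Letter) : Measurable (prodDensity γ ξ v l ψ) := by
  have h : Continuous fun θ => (l.map (val ξ v ψ θ)).prod :=
    continuous_list_prod l fun x _ => continuous_val hξ hv hψ x
  exact ((h.abs.pow 2).const_mul _).measurable.ennreal_ofReal

lemma aemeasurable_prodDensity (hξ : ContDiff ℝ (⊤ : ℕ∞) ξ) (hv : SmoothPos v) (l : List Letter) :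
    AEMeasurable (Function.uncurry (prodDensity γ ξ v l))
      ((volume.restrict (Ioc (0:ℝ) 1)).prod (volume.restrict (Ioc (0:ℝ) (2*π)))) := by
  have h : ContinuousOn (fun z : ℝ × ℝ => (l.map (val ξ v z.1 z.2)).prod)
      (Ioi (0:ℝ) ×ˢ (univ : Set ℝ)) :=
    continuousOn_list_prod l fun x _ => continuousOn_val hξ hv x
  exact (aemeasurable_annulus ((continuousOn_rpow_fst _).mul (h.abs.pow 2))).ennreal_ofReal

lemma prod_density (ξ : ℝ → ℝ) (v : ℝ → ℝ → ℝ) (ψ θ : ℝ) (l : List Letter) :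
    (l.map (density ξ v ψ θ)).prod =
      ENNReal.ofReal ((ψ ^ (l.map psiOrder).sum * (l.map (val ξ v ψ θ)).prod) ^ 2) := by
  induction l with
  | nil => simp
  | cons x l ih =>
    simp only [List.map_cons, List.prod_cons, List.sum_cons, ih, density]
    rw [← ENNReal.ofReal_mul (sq_nonneg _)]
    congr 1
    ring

lemma prodDensity_cons_pert (γ : ℝ) (ξ : ℝ → ℝ) (v : ℝ → ℝ → ℝ) (p q : ℕ) (l : List Letter) {ψ : ℝ}
    (hψ : 0 < ψ) (θ : ℝ) :
    prodDensity γ ξ v (pert p q :: l) ψ θ =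
      kondratevDensity γ v p q ψ θ * (l.map (density ξ v ψ θ)).prod := by
  rw [prod_density, kondratevDensity, ← ENNReal.ofReal_mul (by positivity), prodDensity]
  congr 1
  simp only [List.map_cons, List.sum_cons, List.prod_cons, psiOrder, val]
  have e : ψ ^ (2*((((p + (l.map psiOrder).sum : ℕ)) : ℝ) - γ)) =
      ψ ^ (2*((p:ℝ) - γ)) * (ψ ^ (l.map psiOrder).sum) ^ 2 := by
    rw [← pow_mul, ← Real.rpow_natCast, ← Real.rpow_add hψ]
    congr 1
    push_cast
    ring
  rw [e, abs_mul, mul_pow, mul_pow, sq_abs (List.prod _)]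
  ring

lemma prod_density_le (hγ : 1/2 < γ) (hξ : ContDiff ℝ (⊤ : ℕ∞) ξ) (hv : SmoothPos v)
    {l : List Letter} (hl : ∀ x ∈ l, x.IsBounded m) {ψ θ : ℝ} (hψ : ψ ∈ Ioc (0:ℝ) 1)
    (hθ : θ ∈ Ioc 0 (2*π)) :
    (l.map (density ξ v ψ θ)).prod ≤ bound γ m ξ v ^ l.length := by
  simpa using List.prod_le_pow_card (l.map (density ξ v ψ θ)) (bound γ m ξ v) (by
    intro y hy
    obtain ⟨x, hx, rfl⟩ := List.mem_map.1 hy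
    exact density_le_bound hγ hξ hv (hl x hx) hψ hθ)

lemma lintegral_prodDensity_of_bounded (hγ : 1/2 < γ) (hξ : ContDiff ℝ (⊤ : ℕ∞) ξ)
    (hv : SmoothPos v) (hvK : KNormR γ m v ≠ ⊤) {p q : ℕ} (hpq : p + q ≤ m) {l : List Letter}
    (hl : ∀ x ∈ l, x.IsBounded m) :
    ∫⁻ ψ in Ioc (0:ℝ) 1, ∫⁻ θ in Ioc (0:ℝ) (2*π), prodDensity γ ξ v (pert p q :: l) ψ θ ≤
      bound γ m ξ v ^ (l.length + 1) := by
  have hK : bound γ m ξ v ^ l.length ≠ ⊤ := ENNReal.pow_ne_top (bound_ne_top hξ hvK)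
  calc _ ≤ ∫⁻ ψ in Ioc (0:ℝ) 1, kondratevSlice γ v p q ψ * bound γ m ξ v ^ l.length := by
        refine setLIntegral_mono' measurableSet_Ioc fun ψ hψ => ?_
        rw [kondratevSlice, ← lintegral_mul_const' _ _ hK]
        refine setLIntegral_mono' measurableSet_Ioc fun θ hθ => ?_
        rw [prodDensity_cons_pert γ ξ v p q l hψ.1]
        gcongr
        exact prod_density_le hγ hξ hv hl hψ hθ
    _ ≤ bound γ m ξ v * bound γ m ξ v ^ l.length := by
        rw [lintegral_mul_const' _ _ hK]
        gcongr
        refine (lintegral_kondratevSlice_le γ v hpq).trans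
          (le_trans ?_ (four_mul_KNormSqR_le_bound γ m ξ v))
        exact le_mul_of_one_le_left' (by norm_num)
    _ = _ := by rw [pow_succ']

lemma lintegral_prodDensity_of_sliceBounded (hγ : 1/2 < γ) (hξ : ContDiff ℝ (⊤ : ℕ∞) ξ)
    (hv : SmoothPos v) (hvK : KNormR γ m v ≠ ⊤) {p q : ℕ} (hpq : p + q + 1 ≤ m) {r : Letter}
    (hr : r.IsSliceBounded m) {l : List Letter} (hl : ∀ x ∈ l, x.IsBounded m) :
    ∫⁻ ψ in Ioc (0:ℝ) 1, ∫⁻ θ in Ioc (0:ℝ) (2*π), prodDensity γ ξ v (pert p q :: r :: l) ψ θ ≤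
      bound γ m ξ v ^ (l.length + 2) := by
  have hB := bound_ne_top hξ hvK
  have hK : bound γ m ξ v ^ l.length ≠ ⊤ := ENNReal.pow_ne_top hB
  set K := bound γ m ξ v ^ l.length with hKdef
  calc _ ≤ ∫⁻ ψ in Ioc (0:ℝ) 1, 2 * (kondratevSlice γ v p q ψ + kondratevSlice γ v p (q+1) ψ) *
          (bound γ m ξ v * K) := by
        refine setLIntegral_mono' measurableSet_Ioc fun ψ hψ => ?_
        calc _ ≤ ∫⁻ θ in Ioc (0:ℝ) (2*π), (2 * (kondratevSlice γ v p q ψ +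
                kondratevSlice γ v p (q+1) ψ)) * (density ξ v ψ θ r * K) := by
              refine setLIntegral_mono' measurableSet_Ioc fun θ hθ => ?_
              rw [prodDensity_cons_pert γ ξ v p q _ hψ.1, List.map_cons, List.prod_cons]
              gcongr
              · exact kondratevDensity_le_slice hv p q hψ.1 hθ
              · exact prod_density_le hγ hξ hv hl hψ hθ
          _ ≤ _ := by
              rw [lintegral_const_mul _ ((measurable_density hξ hv hψ.1 r).mul_const _),
                lintegral_mul_const' _ _ hK]
              gcongr
              exact lintegral_density_le_bound hγ hv hr hψ
    _ ≤ bound γ m ξ v * (bound γ m ξ v * K) := by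
        rw [lintegral_mul_const' _ _ (ENNReal.mul_ne_top hB hK),
          lintegral_const_mul' _ _ (by simp)]
        gcongr
        refine le_trans ?_ (four_mul_KNormSqR_le_bound γ m ξ v)
        rw [show (4:ℝ≥0∞) = 2 * 2 by norm_num, mul_assoc]
        gcongr
        exact lintegral_slices_le hv (by omega) (by omega)
    _ = _ := by rw [hKdef]; ring

lemma exists_max_order {P : Letter → Prop} {l : List Letter} (h : ∃ x ∈ l, P x) :
    ∃ x ∈ l, P x ∧ ∀ y ∈ l, P y → y.order ≤ x.order := by
  obtain ⟨x, hx, hmax⟩ := Set.exists_max_image {x | x ∈ l ∧ P x} order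
    ((List.finite_toSet l).subset fun _ hx => hx.1) h
  exact ⟨x, hx.1, hx.2, fun y hy hP => hmax y ⟨hy, hP⟩⟩

lemma exists_perm_cons {α : Type*} {x : α} {l : List α} (h : x ∈ l) :
    ∃ l', l.Perm (x :: l') := by
  obtain ⟨s, t, rfl⟩ := List.append_of_mem h
  exact ⟨s ++ t, List.perm_middle⟩

lemma order_le_sum {x : Letter} {l : List Letter} (h : x ∈ l) : x.order ≤ (l.map order).sum :=
  List.le_sum_of_mem (List.mem_map_of_mem h)

lemma prodDensity_perm {l l' : List Letter} (h : l.Perm l') :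
    prodDensity γ ξ v l = prodDensity γ ξ v l' := by
  funext ψ θ
  rw [prodDensity, prodDensity, (h.map psiOrder).sum_eq, (h.map (val ξ v ψ θ)).prod_eq]

lemma lintegral_prodDensity_le (hm : 2 ≤ m) (hγ : 1/2 < γ) (hξ : ContDiff ℝ (⊤ : ℕ∞) ξ)
    (hv : SmoothPos v) (hvK : KNormR γ m v ≠ ⊤) {l : List Letter}
    (hl : (l.map order).sum ≤ m) (hp : ∃ x ∈ l, x.IsPert) :
    ∫⁻ ψ in Ioc (0:ℝ) 1, ∫⁻ θ in Ioc (0:ℝ) (2*π), prodDensity γ ξ v l ψ θ ≤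
      bound γ m ξ v ^ l.length := by
  obtain ⟨w, hw, hwP, hwmax⟩ := exists_max_order hp
  obtain ⟨l₁, hl₁⟩ := exists_perm_cons hw
  obtain _ | ⟨p, q⟩ := w
  · exact hwP.elim
  replace hwmax : ∀ p' q', pert p' q' ∈ l₁ → p' + q' ≤ p + q := fun p' q' h =>
    hwmax _ (hl₁.mem_iff.2 (List.mem_cons_of_mem _ h)) trivial
  rw [(hl₁.map order).sum_eq, List.map_cons, List.sum_cons] at hl
  change p + q + _ ≤ m at hl
  rw [prodDensity_perm hl₁, hl₁.length_eq, List.length_cons]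
  by_cases hb : ∀ x ∈ l₁, x.IsBounded m
  · exact lintegral_prodDensity_of_bounded hγ hξ hv hvK (by omega) hb
  push Not at hb
  obtain ⟨x₀, hx₀, hx₀b⟩ := hb
  obtain ⟨r, hr, -, hrmax⟩ := exists_max_order (P := fun _ => True) ⟨x₀, hx₀, trivial⟩
  obtain ⟨l₂, hl₂⟩ := exists_perm_cons hr
  have hx₀o := hrmax x₀ hx₀ trivial
  replace hrmax : ∀ x ∈ l₂, x.order ≤ r.order := fun x hx =>
    hrmax x (hl₂.mem_iff.2 (List.mem_cons_of_mem _ hx)) trivial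
  rw [(hl₂.map order).sum_eq, List.map_cons, List.sum_cons] at hl
  have hx₀m : m ≤ x₀.order + 1 := by
    cases x₀ <;> simp only [IsBounded, order] at hx₀b ⊢ <;> omega
  rw [prodDensity_perm (hl₂.cons _), hl₂.length_eq, List.length_cons]
  refine lintegral_prodDensity_of_sliceBounded hγ hξ hv hvK ?_ ?_ ?_
  · omega
  · cases r with
    | base a => simp only [IsSliceBounded, order] at hl ⊢; omega
    | pert p' q' =>
      have := hwmax p' q' hr
      simp only [IsSliceBounded, order] at hl hx₀o ⊢; omega
  · intro x hx
    have h1 := order_le_sum hx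
    have h2 := hrmax x hx
    cases x with
    | base a => simp only [IsBounded, order] at h1 h2 ⊢; omega
    | pert p' q' =>
      have := hwmax p' q' (hl₂.mem_iff.2 (List.mem_cons_of_mem _ hx))
      simp only [IsBounded, order] at h1 h2 ⊢; omega

end Estimates

end Letter

/-! ### The superposition estimate -/

namespace Letter

lemma abs_sub_le_of_hasDerivAt {F F' : ℝ → ℝ} {M : ℝ} (hF : ∀ x, HasDerivAt F (F' x) x)
    (hM : ∀ x, |F' x| ≤ M) (a b : ℝ) : |F (a + b) - F a| ≤ M * |b| := by
  simpa using convex_univ.norm_image_sub_le_of_norm_hasDerivWithin_le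
    (fun x _ => (hF x).hasDerivWithinAt) (fun x _ => hM x) (mem_univ a) (mem_univ (a + b))

lemma IsTerm.exists_dominating {m n p : ℕ} {T : Bool × List Letter} (hT : IsTerm n p T)
    (hn : n ≤ m) :
    ∃ l : List Letter, l.length ≤ m + 1 ∧ (l.map order).sum ≤ m ∧ (l.map psiOrder).sum = p ∧
      (∃ x ∈ l, x.IsPert) ∧
      ∀ (F : ℕ → ℝ → ℝ) (M : ℝ), (∀ k ≤ m, ∀ x, HasDerivAt (F k) (F (k+1) x) x) →
        (∀ k ≤ m + 1, ∀ x, |F k x| ≤ M) → ∀ g : Letter → ℝ,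
        |termVal F g T| ≤ M * |(l.map g).prod| := by
  obtain ⟨d, l⟩ := T
  obtain ⟨h1, h2, h3, h4⟩ := hT
  dsimp only at h1 h2 h3 h4
  cases d
  · refine ⟨l, by omega, by omega, h3, h4 rfl, fun F M _ hM g => ?_⟩
    simp only [termVal, Bool.false_eq_true, if_false, sub_zero, abs_mul]
    exact mul_le_mul_of_nonneg_right (hM _ (by omega) _) (abs_nonneg _)
  · refine ⟨pert 0 0 :: l, by simp; omega, by simp [order]; omega, by simpa [psiOrder] using h3,
      ⟨_, List.mem_cons_self, trivial⟩, fun F M hF hM g => ?_⟩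
    simp only [termVal, if_true, abs_mul, List.map_cons, List.prod_cons, ← mul_assoc]
    exact mul_le_mul_of_nonneg_right (abs_sub_le_of_hasDerivAt (hF _ (by omega))
      (hM _ (by omega)) _ _) (abs_nonneg _)

lemma pow_le_add_pow {N : ℝ≥0∞} {m j : ℕ} (hj : 1 ≤ j) (hjm : j ≤ m + 1) :
    N ^ j ≤ N + N ^ (m + 1) := by
  rcases le_total N 1 with h | h
  · exact (show N ^ j ≤ N by simpa using pow_le_pow_right_of_le_one' h (show 1 ≤ j by omega)).trans le_self_add
  · exact (pow_le_pow_right' h hjm).trans le_add_self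

lemma bound_pow_le (γ : ℝ) (ξ : ℝ → ℝ) (v : ℝ → ℝ → ℝ) {m j : ℕ} (hj : 1 ≤ j) (hjm : j ≤ m + 1) :
    bound γ m ξ v ^ j ≤ (16 * (m + 1)) ^ (m + 1) *
      ((HNormR m ξ + KNormR γ m v) + (HNormR m ξ + KNormR γ m v) ^ (m + 1)) ^ 2 := by
  rw [bound, mul_pow, ← pow_mul, mul_comm 2 j, pow_mul]
  refine mul_le_mul' (pow_le_pow_right' ?_ hjm) (pow_le_pow_left' (pow_le_add_pow hj hjm) 2)
  exact_mod_cast (by omega : 1 ≤ 16 * (m + 1))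

lemma exists_lintegral_sum_termVal_le {m : ℕ} (hm : 2 ≤ m) {γ : ℝ} (hγ : 1/2 < γ) {n p : ℕ}
    (hn : n ≤ m) (L : List (Bool × List Letter)) (hL : ∀ T ∈ L, IsTerm n p T) :
    ∃ D : ℕ, ∀ (F : ℕ → ℝ → ℝ) (M : ℝ), (∀ k ≤ m, ∀ x, HasDerivAt (F k) (F (k+1) x) x) →
      (∀ k ≤ m + 1, ∀ x, |F k x| ≤ M) →
      ∀ ξ : ℝ → ℝ, ContDiff ℝ (⊤ : ℕ∞) ξ → ∀ v : ℝ → ℝ → ℝ, SmoothPos v → KNormR γ m v ≠ ⊤ →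
      ∫⁻ ψ in Ioc (0:ℝ) 1, ∫⁻ θ in Ioc (0:ℝ) (2*π), ENNReal.ofReal (ψ ^ (2*((p:ℝ) - γ)) *
        |(L.map (termVal F (val ξ v ψ θ))).sum| ^ 2) ≤
      D * (ENNReal.ofReal (M ^ 2) * ((16 * (m + 1)) ^ (m + 1) *
        ((HNormR m ξ + KNormR γ m v) + (HNormR m ξ + KNormR γ m v) ^ (m + 1)) ^ 2)) := by
  induction L with
  | nil => exact ⟨0, fun F M _ _ ξ _ v _ _ => by simp⟩
  | cons T L ih =>
    obtain ⟨D, hD⟩ := ih fun T hT => hL T (List.mem_cons_of_mem _ hT)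
    obtain ⟨l, hlen, hord, hpsi, hpert, hdom⟩ := (hL T List.mem_cons_self).exists_dominating hn
    refine ⟨2 + 2 * D, fun F M hF hM ξ hξ v hv hvK => ?_⟩
    have hB := (lintegral_prodDensity_le hm hγ hξ hv hvK hord hpert).trans
      (bound_pow_le γ ξ v (List.length_pos_of_mem hpert.choose_spec.1) hlen)
    specialize hD F M hF hM ξ hξ v hv hvK
    set Y := (16 * ((m:ℝ≥0∞) + 1)) ^ (m + 1) *
      ((HNormR m ξ + KNormR γ m v) + (HNormR m ξ + KNormR γ m v) ^ (m + 1)) ^ 2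
    set E : ℝ → ℝ → ℝ≥0∞ := fun ψ θ => ENNReal.ofReal (ψ ^ (2*((p:ℝ) - γ)) *
        |(L.map (termVal F (val ξ v ψ θ))).sum| ^ 2) with hE
    have hc : 2 * ENNReal.ofReal (M ^ 2) ≠ ⊤ := by finiteness
    have hpt : ∀ ψ ∈ Ioc (0:ℝ) 1, ∀ θ, ENNReal.ofReal (ψ ^ (2*((p:ℝ) - γ)) *
        |((T :: L).map (termVal F (val ξ v ψ θ))).sum| ^ 2) ≤
        2 * ENNReal.ofReal (M ^ 2) * prodDensity γ ξ v l ψ θ + 2 * E ψ θ := by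
      intro ψ hψ θ
      have hw : 0 ≤ ψ ^ (2*((p:ℝ) - γ)) := Real.rpow_nonneg hψ.1.le _
      have h1 := hdom F M hF hM (val ξ v ψ θ)
      rw [hE, prodDensity, hpsi, show (2:ℝ≥0∞) = ENNReal.ofReal 2 by simp,
        ← ENNReal.ofReal_mul (by norm_num), ← ENNReal.ofReal_mul (by positivity),
        ← ENNReal.ofReal_mul (by norm_num), ← ENNReal.ofReal_add (by positivity) (by positivity)]
      refine ENNReal.ofReal_le_ofReal ?_
      rw [List.map_cons, List.sum_cons]
      have h2 := pow_le_pow_left₀ (abs_nonneg _) h1 2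
      rw [mul_pow] at h2
      generalize termVal F (val ξ v ψ θ) T = t at h2 ⊢
      generalize (L.map (termVal F (val ξ v ψ θ))).sum = S
      have h3 : |t + S| ^ 2 ≤ 2 * (M ^ 2 * |(l.map (val ξ v ψ θ)).prod| ^ 2) + 2 * |S| ^ 2 := by
        rw [sq_abs] at h2 ⊢
        rw [sq_abs S]
        nlinarith [sq_nonneg (t - S)]
      calc _ ≤ ψ ^ (2*((p:ℝ) - γ)) *
            (2 * (M ^ 2 * |(l.map (val ξ v ψ θ)).prod| ^ 2) + 2 * |S| ^ 2) := by gcongr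
        _ = _ := by ring
    calc _ ≤ ∫⁻ ψ in Ioc (0:ℝ) 1, (2 * ENNReal.ofReal (M ^ 2) *
            (∫⁻ θ in Ioc (0:ℝ) (2*π), prodDensity γ ξ v l ψ θ) +
            2 * ∫⁻ θ in Ioc (0:ℝ) (2*π), E ψ θ) := by
          refine setLIntegral_mono' measurableSet_Ioc fun ψ hψ => ?_
          rw [← lintegral_const_mul' _ _ hc, ← lintegral_const_mul' _ _ (by simp),
            ← lintegral_add_left ((measurable_prodDensity hξ hv hψ.1 l).const_mul _)]
          exact lintegral_mono fun θ => hpt ψ hψ θ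
      _ = 2 * ENNReal.ofReal (M ^ 2) * (∫⁻ ψ in Ioc (0:ℝ) 1,
            ∫⁻ θ in Ioc (0:ℝ) (2*π), prodDensity γ ξ v l ψ θ) +
            2 * ∫⁻ ψ in Ioc (0:ℝ) 1, ∫⁻ θ in Ioc (0:ℝ) (2*π), E ψ θ := by
          rw [← lintegral_const_mul' _ _ hc, ← lintegral_const_mul' _ _ (by simp)]
          exact lintegral_add_left'
            ((aemeasurable_prodDensity hξ hv l).lintegral_prod_right'.const_mul _) _
      _ ≤ 2 * ENNReal.ofReal (M ^ 2) * Y + 2 * (D * (ENNReal.ofReal (M ^ 2) * Y)) := by gcongr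
      _ = _ := by push_cast; ring

end Letter

lemma exists_lintegral_pderR_superposition_le {m : ℕ} (hm : 2 ≤ m) {γ : ℝ} (hγ : 1/2 < γ)
    (p q : ℕ) : ∃ D : ℕ, p + q ≤ m → ∀ (f : ℝ → ℝ) (M : ℝ), ContDiff ℝ ((m+1 : ℕ) : ℕ∞) f →
      (∀ j ≤ m+1, ∀ x : ℝ, |iteratedDeriv j f x| ≤ M) →
      ∀ ξ : ℝ → ℝ, ContDiff ℝ (⊤ : ℕ∞) ξ → ∀ v : ℝ → ℝ → ℝ, SmoothPos v → KNormR γ m v ≠ ⊤ →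
      ∫⁻ ψ in Ioc (0:ℝ) 1, ∫⁻ θ in Ioc (0:ℝ) (2*π), ENNReal.ofReal (ψ ^ (2*((p:ℝ) - γ)) *
        |pderR p q (fun ψ θ => f (ξ θ + v ψ θ) - f (ξ θ)) ψ θ| ^ 2) ≤
      D * (ENNReal.ofReal (M ^ 2) * ((16 * (m + 1)) ^ (m + 1) *
        ((HNormR m ξ + KNormR γ m v) + (HNormR m ξ + KNormR γ m v) ^ (m + 1)) ^ 2)) := by
  by_cases hpq : p + q ≤ m
  · obtain ⟨L, hL, hexp⟩ := Letter.exists_expansion p q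
    obtain ⟨D, hD⟩ := Letter.exists_lintegral_sum_termVal_le hm hγ hpq L hL
    refine ⟨D, fun _ f M hf hM ξ hξ v hv hvK => ?_⟩
    have hf' : ∀ k ≤ m, ∀ x, HasDerivAt (iteratedDeriv k f) (iteratedDeriv (k+1) f x) x := by
      intro k hk x
      rw [iteratedDeriv_succ]
      exact (hf.differentiable_iteratedDeriv k
        (by exact_mod_cast Nat.lt_succ_of_le hk) x).hasDerivAt
    refine le_trans (le_of_eq ?_) (hD (fun k => iteratedDeriv k f) M hf' hM ξ hξ v hv hvK)
    refine setLIntegral_congr_fun measurableSet_Ioc fun ψ hψ => ?_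
    refine lintegral_congr fun θ => ?_
    rw [hexp f (fun k hk => hf' k (by omega)) ξ hξ v hv ψ hψ.1 θ]
  · exact ⟨0, fun h => absurd h hpq⟩

/-- **Superposition estimate in `J_{0,γ}^m`**: for `m ≥ 2`, `γ > 1/2`, there is `C > 0`
such that for `f ∈ C^(m+1)(ℝ)` with `‖f‖_{C^(m+1)} ≤ M`, smooth `ξ : 𝕋 → ℝ`,
smooth `v ∈ K_γ^m(Π)`, and `N = ‖ξ‖_{H^m(𝕋)} + ‖v‖_{K_γ^m}`, one has
`‖f(ξ + v) − f(ξ)‖_{K_γ^m} ≤ C ‖f‖_{C^(m+1)} (N + N^(m+1))`. -/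
theorem superposition_remainder_kondratev (m : ℕ) (hm : 2 ≤ m) (γ : ℝ) (hγ : 1/2 < γ) :
    ∃ C > 0, ∀ (f : ℝ → ℝ) (M : ℝ), ContDiff ℝ ((m+1 : ℕ) : ℕ∞) f →
      (∀ j ≤ m+1, ∀ x : ℝ, |iteratedDeriv j f x| ≤ M) →
      ∀ ξ : ℝ → ℝ, ContDiff ℝ (⊤ : ℕ∞) ξ → (∀ θ, ξ (θ + 2*π) = ξ θ) →
      ∀ v : ℝ → ℝ → ℝ, SmoothAnnR v → KNormR γ m v ≠ ⊤ →
      KNormR γ m (fun ψ θ => f (ξ θ + v ψ θ) - f (ξ θ)) ≤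
        ENNReal.ofReal (C * M) *
          ((HNormR m ξ + KNormR γ m v) + (HNormR m ξ + KNormR γ m v) ^ (m+1)) := by
  choose D hD using exists_lintegral_pderR_superposition_le hm hγ
  set A : ℕ := (∑ p ∈ Finset.range (m+1), ∑ q ∈ Finset.range (m+1-p), D p q) *
    (16 * (m + 1)) ^ (m + 1) with hA
  refine ⟨A + 1, by positivity, fun f M hf hM ξ hξ _ v hv hvK => ?_⟩
  have hM0 : 0 ≤ M := (abs_nonneg _).trans (hM 0 (Nat.zero_le _) 0)
  set Y := (HNormR m ξ + KNormR γ m v) + (HNormR m ξ + KNormR γ m v) ^ (m+1) with hY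
  have hsq : KNormSqR γ m (fun ψ θ => f (ξ θ + v ψ θ) - f (ξ θ)) ≤
      (ENNReal.ofReal ((A + 1) * M) * Y) ^ 2 := by
    calc KNormSqR γ m (fun ψ θ => f (ξ θ + v ψ θ) - f (ξ θ))
        ≤ ∑ p ∈ Finset.range (m+1), ∑ q ∈ Finset.range (m+1-p),
            (D p q : ℝ≥0∞) * (ENNReal.ofReal (M ^ 2) * ((16 * (m + 1)) ^ (m + 1) * Y ^ 2)) := by
          refine Finset.sum_le_sum fun p hp => Finset.sum_le_sum fun q hq => ?_
          rw [Finset.mem_range] at hp hq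
          exact hD p q (by omega) f M hf hM ξ hξ v hv.1 hvK
      _ = A * (ENNReal.ofReal M ^ 2 * Y ^ 2) := by
          simp only [← Finset.sum_mul]
          rw [hA, ENNReal.ofReal_pow hM0]
          push_cast
          ring
      _ ≤ ((A + 1 : ℕ) : ℝ≥0∞) ^ 2 * (ENNReal.ofReal M ^ 2 * Y ^ 2) := by
          gcongr
          exact_mod_cast (by nlinarith : A ≤ (A + 1) ^ 2)
      _ = _ := by
          rw [ENNReal.ofReal_mul (by positivity), mul_pow, mul_pow, mul_assoc]
          congr 2
          rw [← ENNReal.ofReal_natCast]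
          push_cast
          rfl
  calc KNormR γ m (fun ψ θ => f (ξ θ + v ψ θ) - f (ξ θ))
      ≤ ((ENNReal.ofReal ((A + 1) * M) * Y) ^ 2) ^ ((1:ℝ)/2) :=
        ENNReal.rpow_le_rpow hsq (by norm_num)
    _ = ENNReal.ofReal ((A + 1) * M) * Y := by
        rw [← ENNReal.rpow_natCast, ← ENNReal.rpow_mul]
        norm_num
end
end

section
/- Let k be an integer with |k| ≥ 3 and let γ < 1 be a real number. Let η : (0,1] → ℂ be measurable with ∫₀¹ ψ^{−1−2γ} |η(ψ)|² dψ < ∞, and define w(ψ) = −ψ^{(|k|−1)/2} ∫_ψ^1 t^{−(1+|k|)/2} η(t) dt. Then ( ∫₀¹ ψ^{−1−2γ} |w(ψ)|² dψ )^{1/2} ≤ (|k|/2 − γ − 1/2)^{−1} ( ∫₀¹ ψ^{−1−2γ} |η(ψ)|² dψ )^{1/2}. -/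
open MeasureTheory Real Set ENNReal

noncomputable section

/-- The squared form of the Cauchy-Schwarz inequality for the Lebesgue integral. -/
lemma sq_lintegral_mul_le {α : Type*} [MeasurableSpace α] (μ : Measure α) {f g : α → ℝ≥0∞}
    (hf : Measurable f) (hg : Measurable g) :
    (∫⁻ a, f a * g a ∂μ) ^ 2 ≤ (∫⁻ a, f a ^ 2 ∂μ) * ∫⁻ a, g a ^ 2 ∂μ := by
  have h := ENNReal.lintegral_mul_le_Lp_mul_Lq μ Real.HolderConjugate.two_two
    hf.aemeasurable hg.aemeasurable
  calc (∫⁻ a, f a * g a ∂μ) ^ 2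
      ≤ ((∫⁻ a, f a ^ (2 : ℝ) ∂μ) ^ (1 / 2 : ℝ) * (∫⁻ a, g a ^ (2 : ℝ) ∂μ) ^ (1 / 2 : ℝ)) ^ 2 := by
        gcongr
        exact h
    _ = (∫⁻ a, f a ^ 2 ∂μ) * ∫⁻ a, g a ^ 2 ∂μ := by
        rw [mul_pow, ← ENNReal.rpow_mul_natCast, ← ENNReal.rpow_mul_natCast]
        norm_num

lemma lintegral_Ioc_rpow_sub_one {c t : ℝ} (hc : 0 < c) (ht : 0 ≤ t) :
    ∫⁻ s in Ioc 0 t, ENNReal.ofReal (s ^ (c - 1)) = ENNReal.ofReal (c⁻¹ * t ^ c) := by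
  have hint : IntervalIntegrable (fun s : ℝ => s ^ (c - 1)) volume 0 t :=
    intervalIntegral.intervalIntegrable_rpow' (by linarith)
  rw [← ofReal_integral_eq_lintegral_ofReal
      ((intervalIntegrable_iff_integrableOn_Ioc_of_le ht).1 hint),
    ← intervalIntegral.integral_of_le ht, integral_rpow (Or.inl (by linarith))]
  · rw [sub_add_cancel, Real.zero_rpow hc.ne', sub_zero, div_eq_inv_mul]
  · filter_upwards [ae_restrict_mem measurableSet_Ioc] with s hs
    exact Real.rpow_nonneg hs.1.le _

lemma lintegral_Ioc_rpow_neg_sub_one_le {c x y : ℝ} (hc : 0 < c) (hx : 0 < x) (hxy : x ≤ y) :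
    ∫⁻ t in Ioc x y, ENNReal.ofReal (t ^ (-c - 1)) ≤ ENNReal.ofReal (c⁻¹ * x ^ (-c)) := by
  have h0 : (0 : ℝ) ∉ uIcc x y := by
    rw [uIcc_of_le hxy]
    exact fun h => absurd h.1 (not_le.2 hx)
  have hint : IntervalIntegrable (fun s : ℝ => s ^ (-c - 1)) volume x y :=
    intervalIntegral.intervalIntegrable_rpow (Or.inr h0)
  rw [← ofReal_integral_eq_lintegral_ofReal
      ((intervalIntegrable_iff_integrableOn_Ioc_of_le hxy).1 hint),
    ← intervalIntegral.integral_of_le hxy,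
    integral_rpow (Or.inr ⟨by linarith, h0⟩)]
  · apply ENNReal.ofReal_le_ofReal
    have hy : 0 ≤ c⁻¹ * y ^ (-c) :=
      mul_nonneg (inv_nonneg.2 hc.le) (Real.rpow_nonneg (hx.le.trans hxy) _)
    have e : (y ^ (-c) - x ^ (-c)) / (-c) = c⁻¹ * x ^ (-c) - c⁻¹ * y ^ (-c) := by
      field_simp
      ring
    rw [sub_add_cancel, e]
    linarith
  · filter_upwards [ae_restrict_mem measurableSet_Ioc] with s hs
    exact Real.rpow_nonneg (hx.le.trans hs.1.le) _

/-- Tonelli's theorem on the triangle `{(s, t) | 0 < s < t ≤ 1}`. -/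
lemma lintegral_Ioc_lintegral_Ioc_swap {K f : ℝ → ℝ≥0∞} (hK : Measurable K) (hf : Measurable f) :
    ∫⁻ s in Ioc (0 : ℝ) 1, K s * ∫⁻ t in Ioc s 1, f t
      = ∫⁻ t in Ioc (0 : ℝ) 1, f t * ∫⁻ s in Ioc 0 t, K s := by
  have hS : MeasurableSet {p : ℝ × ℝ | p.1 < p.2} := measurableSet_lt measurable_fst measurable_snd
  have hmeas : Measurable ({p : ℝ × ℝ | p.1 < p.2}.indicator fun p => K p.1 * f p.2) :=
    ((hK.comp measurable_fst).mul (hf.comp measurable_snd)).indicator hS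
  calc ∫⁻ s in Ioc (0 : ℝ) 1, K s * ∫⁻ t in Ioc s 1, f t
      = ∫⁻ s in Ioc (0 : ℝ) 1, ∫⁻ t in Ioc (0 : ℝ) 1,
          {p : ℝ × ℝ | p.1 < p.2}.indicator (fun p => K p.1 * f p.2) (s, t) := by
        refine setLIntegral_congr_fun measurableSet_Ioc fun s hs => ?_
        have e : Ioc s 1 = Ioi s ∩ Ioc 0 1 := by
          ext t
          simp only [mem_Ioc, mem_inter_iff, mem_Ioi]
          exact ⟨fun h => ⟨h.1, hs.1.trans h.1, h.2⟩, fun h => ⟨h.1, h.2.2⟩⟩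
        rw [← lintegral_const_mul _ hf, e, ← Measure.restrict_restrict measurableSet_Ioi,
          ← lintegral_indicator measurableSet_Ioi]
        rfl
    _ = ∫⁻ t in Ioc (0 : ℝ) 1, ∫⁻ s in Ioc (0 : ℝ) 1,
          {p : ℝ × ℝ | p.1 < p.2}.indicator (fun p => K p.1 * f p.2) (s, t) :=
        lintegral_lintegral_swap hmeas.aemeasurable
    _ = ∫⁻ t in Ioc (0 : ℝ) 1, f t * ∫⁻ s in Ioc 0 t, K s := by
        refine setLIntegral_congr_fun measurableSet_Ioc fun t ht => ?_
        have e : Iio t ∩ Ioc 0 1 = Ioo 0 t := by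
          ext s
          simp only [mem_Ioc, mem_inter_iff, mem_Iio, mem_Ioo]
          exact ⟨fun h => ⟨h.2.1, h.1⟩, fun h => ⟨h.2, h.1, h.2.le.trans ht.2⟩⟩
        rw [← restrict_Ioo_eq_restrict_Ioc (b := t), ← lintegral_const_mul _ hK, ← e,
          ← Measure.restrict_restrict measurableSet_Iio, ← lintegral_indicator measurableSet_Iio]
        refine lintegral_congr fun s => ?_
        simp only [indicator, mem_ofPred_eq, mem_Iio, mul_comm]

/-- Hardy's inequality in weighted `L²` form on `(0, 1]`, for the dual averaging operator. -/
lemma lintegral_hardy_dual {c : ℝ} (hc : 0 < c) {h : ℝ → ℝ≥0∞} (hh : Measurable h) :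
    ∫⁻ s in Ioc (0 : ℝ) 1, ENNReal.ofReal (s ^ (2 * c - 1)) *
        (∫⁻ t in Ioc s 1, ENNReal.ofReal (t ^ (-c - 1 / 2)) * h t) ^ 2
      ≤ ENNReal.ofReal c⁻¹ ^ 2 * ∫⁻ t in Ioc (0 : ℝ) 1, h t ^ 2 := by
  have hpow (a : ℝ) : Measurable fun t : ℝ => ENNReal.ofReal (t ^ a) := by fun_prop
  have hsq {t : ℝ} (ht : 0 ≤ t) (a b : ℝ) (hab : b = a + a) (hb : b ≠ 0) :
      ENNReal.ofReal (t ^ a) ^ 2 = ENNReal.ofReal (t ^ b) := by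
    rw [← ENNReal.ofReal_pow (Real.rpow_nonneg ht _), sq, hab, Real.rpow_add' ht (hab ▸ hb)]
  have hpt {s : ℝ} (hs : s ∈ Ioc (0 : ℝ) 1) :
      (∫⁻ t in Ioc s 1, ENNReal.ofReal (t ^ (-c - 1 / 2)) * h t) ^ 2
        ≤ ENNReal.ofReal (c⁻¹ * s ^ (-c)) * ∫⁻ t in Ioc s 1, ENNReal.ofReal (t ^ (-c)) * h t ^ 2 := by
    calc (∫⁻ t in Ioc s 1, ENNReal.ofReal (t ^ (-c - 1 / 2)) * h t) ^ 2
        = (∫⁻ t in Ioc s 1, ENNReal.ofReal (t ^ ((-c - 1) / 2)) *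
            (ENNReal.ofReal (t ^ (-c / 2)) * h t)) ^ 2 := by
          congr 1
          refine setLIntegral_congr_fun measurableSet_Ioc fun t ht => ?_
          have ht0 : 0 < t := hs.1.trans ht.1
          rw [← mul_assoc, ← ENNReal.ofReal_mul (Real.rpow_nonneg ht0.le _), ← Real.rpow_add ht0]
          ring_nf
      _ ≤ _ := sq_lintegral_mul_le _ (hpow _) ((hpow _).mul hh)
      _ = (∫⁻ t in Ioc s 1, ENNReal.ofReal (t ^ (-c - 1))) *
            ∫⁻ t in Ioc s 1, ENNReal.ofReal (t ^ (-c)) * h t ^ 2 := by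
          congr 1 <;> refine setLIntegral_congr_fun measurableSet_Ioc fun t ht => ?_ <;>
            have ht0 : 0 < t := hs.1.trans ht.1
          · exact hsq ht0.le _ _ (by ring) (by linarith)
          · rw [mul_pow, hsq ht0.le _ (-c) (by ring) (by linarith)]
      _ ≤ _ := by
          gcongr
          exact lintegral_Ioc_rpow_neg_sub_one_le hc hs.1 hs.2
  calc ∫⁻ s in Ioc (0 : ℝ) 1, ENNReal.ofReal (s ^ (2 * c - 1)) *
        (∫⁻ t in Ioc s 1, ENNReal.ofReal (t ^ (-c - 1 / 2)) * h t) ^ 2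
      ≤ ∫⁻ s in Ioc (0 : ℝ) 1, (ENNReal.ofReal c⁻¹ * ENNReal.ofReal (s ^ (c - 1))) *
          ∫⁻ t in Ioc s 1, ENNReal.ofReal (t ^ (-c)) * h t ^ 2 := by
        refine setLIntegral_mono' measurableSet_Ioc fun s hs => ?_
        refine (mul_le_mul_right (hpt hs) _).trans_eq ?_
        rw [← mul_assoc, ← ENNReal.ofReal_mul (Real.rpow_nonneg hs.1.le _),
          ← ENNReal.ofReal_mul (inv_nonneg.2 hc.le), mul_left_comm, ← Real.rpow_add hs.1]
        ring_nf
    _ = ∫⁻ t in Ioc (0 : ℝ) 1, (ENNReal.ofReal (t ^ (-c)) * h t ^ 2) *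
          ∫⁻ s in Ioc 0 t, ENNReal.ofReal c⁻¹ * ENNReal.ofReal (s ^ (c - 1)) :=
        lintegral_Ioc_lintegral_Ioc_swap ((hpow _).const_mul _) ((hpow _).mul (hh.pow_const 2))
    _ = ∫⁻ t in Ioc (0 : ℝ) 1, ENNReal.ofReal c⁻¹ ^ 2 * h t ^ 2 := by
        refine setLIntegral_congr_fun measurableSet_Ioc fun t ht => ?_
        have hcancel : ENNReal.ofReal (t ^ (-c)) * ENNReal.ofReal (t ^ c) = 1 := by
          rw [← ENNReal.ofReal_mul (Real.rpow_nonneg ht.1.le _), ← Real.rpow_add ht.1,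
            neg_add_cancel, Real.rpow_zero, ENNReal.ofReal_one]
        rw [lintegral_const_mul _ (hpow _), lintegral_Ioc_rpow_sub_one hc ht.1.le,
          ENNReal.ofReal_mul (inv_nonneg.2 hc.le)]
        calc _ = (ENNReal.ofReal (t ^ (-c)) * ENNReal.ofReal (t ^ c)) *
              (ENNReal.ofReal c⁻¹ ^ 2 * h t ^ 2) := by ring
          _ = _ := by rw [hcancel, one_mul]
    _ = _ := lintegral_const_mul _ (hh.pow_const 2)

/-- **Weighted bound for the inverse of `L_k⁻ = ψD + ((1-|k|)/2)I`, high modes.**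
For `|k| ≥ 3`, `γ < 1` and `η` with `∫₀¹ ψ^(-1-2γ)|η|² dψ < ∞`, the function
`w(ψ) = -ψ^((|k|-1)/2) ∫_ψ^1 t^(-(1+|k|)/2) η(t) dt` satisfies
`‖ψ^(-1/2-γ) w‖_{L²[0,1]} ≤ (|k|/2 - γ - 1/2)⁻¹ ‖ψ^(-1/2-γ) η‖_{L²[0,1]}`. -/
theorem Lk_minus_inverse_bound_high (k : ℤ) (hk : 3 ≤ |k|) (γ : ℝ) (hγ : γ < 1)
    (η : ℝ → ℂ) (hmeas : Measurable η)
    (hfin : (∫⁻ ψ in Ioc (0:ℝ) 1,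
        ENNReal.ofReal (ψ ^ (-1 - 2*γ) * ‖η ψ‖^2)) ≠ ⊤) :
    (∫⁻ ψ in Ioc (0:ℝ) 1, ENNReal.ofReal (ψ ^ (-1 - 2*γ) *
        ‖-((ψ ^ ((((|k| : ℤ) : ℝ) - 1)/2) : ℝ) •
          ∫ t in ψ..(1:ℝ), ((t ^ (-(1 + ((|k| : ℤ) : ℝ))/2) : ℝ)) • η t)‖^2)) ^ ((1:ℝ)/2)
      ≤ ENNReal.ofReal (((|k| : ℤ) : ℝ)/2 - γ - 1/2)⁻¹ *
        (∫⁻ ψ in Ioc (0:ℝ) 1,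
          ENNReal.ofReal (ψ ^ (-1 - 2*γ) * ‖η ψ‖^2)) ^ ((1:ℝ)/2) := by
  set m : ℝ := ((|k| : ℤ) : ℝ) with hm
  have hm3 : (3 : ℝ) ≤ m := by rw [hm]; exact_mod_cast hk
  set c : ℝ := m / 2 - γ - 1 / 2 with hcdef
  have hc : 0 < c := by linarith
  set h : ℝ → ℝ≥0∞ := fun t => ENNReal.ofReal (t ^ (-1 / 2 - γ)) * ‖η t‖ₑ with hh
  have hhmeas : Measurable h := by fun_prop
  have hη : ∫⁻ ψ in Ioc (0 : ℝ) 1, ENNReal.ofReal (ψ ^ (-1 - 2 * γ) * ‖η ψ‖ ^ 2)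
      = ∫⁻ t in Ioc (0 : ℝ) 1, h t ^ 2 := by
    refine setLIntegral_congr_fun measurableSet_Ioc fun t ht => ?_
    simp only [hh]
    rw [mul_pow, ← ENNReal.ofReal_pow (Real.rpow_nonneg ht.1.le _), ← ofReal_norm,
      ← ENNReal.ofReal_pow (norm_nonneg _), ← ENNReal.ofReal_mul (by positivity), sq (_ ^ _),
      ← Real.rpow_add ht.1]
    ring_nf
  have hw : ∫⁻ ψ in Ioc (0 : ℝ) 1, ENNReal.ofReal (ψ ^ (-1 - 2 * γ) *
        ‖-((ψ ^ ((m - 1) / 2) : ℝ) • ∫ t in ψ..(1 : ℝ), ((t ^ (-(1 + m) / 2) : ℝ)) • η t)‖ ^ 2)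
      ≤ ∫⁻ s in Ioc (0 : ℝ) 1, ENNReal.ofReal (s ^ (2 * c - 1)) *
        (∫⁻ t in Ioc s 1, ENNReal.ofReal (t ^ (-c - 1 / 2)) * h t) ^ 2 := by
    refine setLIntegral_mono' measurableSet_Ioc fun s hs => ?_
    have hI : ‖∫ t in s..(1 : ℝ), ((t ^ (-(1 + m) / 2) : ℝ)) • η t‖ₑ
        ≤ ∫⁻ t in Ioc s 1, ENNReal.ofReal (t ^ (-c - 1 / 2)) * h t := by
      rw [intervalIntegral.integral_of_le hs.2]
      refine (enorm_integral_le_lintegral_enorm _).trans_eq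
        (setLIntegral_congr_fun measurableSet_Ioc fun t ht => ?_)
      have ht0 : 0 < t := hs.1.trans ht.1
      simp only [hh]
      rw [enorm_smul, Real.enorm_of_nonneg (Real.rpow_nonneg ht0.le _), ← mul_assoc,
        ← ENNReal.ofReal_mul (Real.rpow_nonneg ht0.le _), ← Real.rpow_add ht0, hcdef]
      ring_nf
    refine le_trans (le_of_eq ?_) (mul_le_mul_right (pow_le_pow_left' hI 2) _)
    rw [norm_neg, norm_smul, Real.norm_of_nonneg (Real.rpow_nonneg hs.1.le _), mul_pow, ← mul_assoc,
      sq (s ^ _), ← Real.rpow_add hs.1, ← Real.rpow_add hs.1,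
      ENNReal.ofReal_mul (Real.rpow_nonneg hs.1.le _), ENNReal.ofReal_pow (norm_nonneg _),
      ofReal_norm, hcdef]
    ring_nf
  rw [hη]
  calc _ ≤ (ENNReal.ofReal c⁻¹ ^ 2 * ∫⁻ t in Ioc (0 : ℝ) 1, h t ^ 2) ^ ((1 : ℝ) / 2) :=
        ENNReal.rpow_le_rpow (hw.trans (lintegral_hardy_dual hc hhmeas)) (by norm_num)
    _ = _ := by
        rw [ENNReal.mul_rpow_of_nonneg _ _ (by norm_num), ← ENNReal.rpow_natCast_mul]
        norm_num
end
end

section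
/- Let m ≥ 0 be an integer and let γ be a real number with 1/2 ≤ γ < 1. Then there exists a constant C > 0 such that for every integer k with |k| ≥ 3, Σ_{p+q=0}^{m} k^{2q} ∫₀¹ ψ^{2(p − 1/2 − γ)} | (d^p/dψ^p) ψ^{(|k|−1)/2} |² dψ ≤ C (1 + k²)^{m − 1/2}, where the sum is over all pairs of nonnegative integers p, q with p + q ≤ m. -/
open MeasureTheory Real Set ENNReal

noncomputable section

lemma abs_descPochhammer_eval_le (a : ℝ) (p : ℕ) :
    |(descPochhammer ℝ p).eval a| ≤ (|a| + p) ^ p := by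
  rw [descPochhammer_eval_eq_prod_range, Finset.abs_prod]
  calc ∏ i ∈ Finset.range p, |a - i| ≤ ∏ _i ∈ Finset.range p, (|a| + (p : ℝ)) := by
        refine Finset.prod_le_prod (fun _ _ => abs_nonneg _) fun i hi => ?_
        have hip : (i : ℝ) ≤ p := by exact_mod_cast (Finset.mem_range.mp hi).le
        have := abs_sub a (i : ℝ)
        rw [abs_of_nonneg (Nat.cast_nonneg i : (0 : ℝ) ≤ i)] at this
        linarith
    _ = (|a| + p) ^ p := by simp

lemma lintegral_rpow_Ioc_zero_one {r : ℝ} (hr : -1 < r) :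
    ∫⁻ x in Ioc (0 : ℝ) 1, ENNReal.ofReal (x ^ r) = ENNReal.ofReal (1 / (r + 1)) := by
  rw [← ofReal_integral_eq_lintegral_ofReal]
  · rw [← intervalIntegral.integral_of_le zero_le_one, integral_rpow (Or.inl hr),
      Real.one_rpow, Real.zero_rpow (by linarith), sub_zero]
  · exact (intervalIntegrable_iff_integrableOn_Ioc_of_le zero_le_one).mp
      (intervalIntegral.intervalIntegrable_rpow' hr)
  · filter_upwards [ae_restrict_mem measurableSet_Ioc] with x hx
    exact rpow_nonneg hx.1.le r

lemma rpow_mul_sq_abs_iteratedDeriv_rpow (a b : ℝ) (p : ℕ) {x : ℝ} (hx : 0 < x) :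
    x ^ (2 * ((p : ℝ) - b)) * |iteratedDeriv p (fun s : ℝ => s ^ a) x| ^ 2
      = ((descPochhammer ℝ p).eval a) ^ 2 * x ^ (2 * (a - b)) := by
  rw [iteratedDeriv_eq_iterate, Real.iter_deriv_rpow_const, sq_abs, mul_pow,
    ← rpow_natCast (x ^ (a - p)),
    ← rpow_mul hx.le, mul_left_comm, ← rpow_add hx]
  congr 2
  push_cast
  ring

lemma lintegral_weighted_iteratedDeriv_rpow {a b : ℝ} (p : ℕ) (hab : -1 < 2 * (a - b)) :
    ∫⁻ x in Ioc (0 : ℝ) 1, ENNReal.ofReal (x ^ (2 * ((p : ℝ) - b)) *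
        |iteratedDeriv p (fun s : ℝ => s ^ a) x| ^ 2)
      = ENNReal.ofReal (((descPochhammer ℝ p).eval a) ^ 2 / (2 * (a - b) + 1)) := by
  have hcongr : ∀ x ∈ Ioc (0 : ℝ) 1, ENNReal.ofReal (x ^ (2 * ((p : ℝ) - b)) *
        |iteratedDeriv p (fun s : ℝ => s ^ a) x| ^ 2)
      = ENNReal.ofReal (((descPochhammer ℝ p).eval a) ^ 2) *
        ENNReal.ofReal (x ^ (2 * (a - b))) := fun x hx => by
    rw [rpow_mul_sq_abs_iteratedDeriv_rpow a b p hx.1, ENNReal.ofReal_mul (sq_nonneg _)]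
  rw [setLIntegral_congr_fun measurableSet_Ioc hcongr,
    lintegral_const_mul' _ _ ENNReal.ofReal_ne_top, lintegral_rpow_Ioc_zero_one hab,
    ← ENNReal.ofReal_mul (sq_nonneg _), mul_one_div]

/-- The contribution of a single pair `(p, q)`, with `K = |k|`. -/
lemma pow_mul_descPochhammer_sq_div_le {m p q : ℕ} {γ K : ℝ} (hγ0 : 0 ≤ γ) (hγ : γ < 1)
    (hK : 3 ≤ K) (hpq : p + q ≤ m) :
    K ^ (2 * q) * (((descPochhammer ℝ p).eval ((K - 1) / 2)) ^ 2 /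
        (2 * ((K - 1) / 2 - (1 / 2 + γ)) + 1))
      ≤ ((m : ℝ) + 1) ^ (2 * m) * (3 / (1 - γ)) * (1 + K ^ 2) ^ ((m : ℝ) - 1 / 2) := by
  have hK0 : 0 < K := by linarith
  have hm1 : (1 : ℝ) ≤ (m : ℝ) + 1 := by simp
  have hγ' : 0 < 1 - γ := by linarith
  have hpm : (p : ℝ) ≤ m := by exact_mod_cast (by omega : p ≤ m)
  have hpoch : ((descPochhammer ℝ p).eval ((K - 1) / 2)) ^ 2 ≤
      ((m : ℝ) + 1) ^ (2 * m) * K ^ (2 * p) := by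
    have h1 := abs_descPochhammer_eval_le ((K - 1) / 2) p
    rw [abs_of_nonneg (by linarith : 0 ≤ (K - 1) / 2)] at h1
    have h2 : (K - 1) / 2 + p ≤ ((m : ℝ) + 1) * K := by nlinarith
    calc ((descPochhammer ℝ p).eval ((K - 1) / 2)) ^ 2
        = |(descPochhammer ℝ p).eval ((K - 1) / 2)| ^ 2 := (sq_abs _).symm
      _ ≤ ((((m : ℝ) + 1) * K) ^ p) ^ 2 := by
          have h3 : 0 ≤ (K - 1) / 2 + p := add_nonneg (by linarith) p.cast_nonneg
          gcongr
          exact h1.trans (by gcongr)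
      _ = ((m : ℝ) + 1) ^ (2 * p) * K ^ (2 * p) := by rw [← pow_mul, mul_pow, mul_comm p 2]
      _ ≤ _ := by gcongr; omega
  have hsqrt : (1 + K ^ 2) ^ (1 / 2 : ℝ) ≤ 2 * K := by
    rw [← Real.sqrt_eq_rpow]
    exact Real.sqrt_le_iff.mpr ⟨by positivity, by nlinarith⟩
  have hden : (1 - γ) * (2 * K) / 3 ≤ 2 * ((K - 1) / 2 - (1 / 2 + γ)) + 1 := by nlinarith
  have hpow : K ^ (2 * q) * K ^ (2 * p) ≤ (1 + K ^ 2) ^ m := by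
    rw [← pow_add, ← mul_add, pow_mul]
    calc (K ^ 2) ^ (q + p) ≤ (1 + K ^ 2) ^ (q + p) := by gcongr; linarith
      _ ≤ (1 + K ^ 2) ^ m := pow_le_pow_right₀ (by nlinarith) (by omega)
  have hS : 0 < (1 + K ^ 2) ^ (1 / 2 : ℝ) := by positivity
  have hden' : (1 - γ) / 3 * (1 + K ^ 2) ^ (1 / 2 : ℝ) ≤
      2 * ((K - 1) / 2 - (1 / 2 + γ)) + 1 := by
    refine le_trans ?_ hden
    nlinarith
  rw [Real.rpow_sub (by positivity), Real.rpow_natCast]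
  calc K ^ (2 * q) * (((descPochhammer ℝ p).eval ((K - 1) / 2)) ^ 2 /
        (2 * ((K - 1) / 2 - (1 / 2 + γ)) + 1))
      ≤ K ^ (2 * q) * ((((m : ℝ) + 1) ^ (2 * m) * K ^ (2 * p)) /
        ((1 - γ) / 3 * (1 + K ^ 2) ^ (1 / 2 : ℝ))) := by gcongr
    _ = (((m : ℝ) + 1) ^ (2 * m) * (3 / (1 - γ)) / (1 + K ^ 2) ^ (1 / 2 : ℝ)) *
          (K ^ (2 * q) * K ^ (2 * p)) := by field_simp
    _ ≤ (((m : ℝ) + 1) ^ (2 * m) * (3 / (1 - γ)) / (1 + K ^ 2) ^ (1 / 2 : ℝ)) *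
          (1 + K ^ 2) ^ m := by gcongr
    _ = _ := by ring

/-- **Mode-wise Kondratev estimate for the homogeneous solutions** `ψ^((|k|-1)/2)`:
for `m ≥ 0` and `1/2 ≤ γ < 1` there is `C > 0` such that for every `|k| ≥ 3`,
`Σ_{p+q≤m} k^(2q) ∫₀¹ ψ^(2(p - 1/2 - γ)) |D^p ψ^((|k|-1)/2)|² dψ ≤ C (1+k²)^(m-1/2)`. -/
theorem homogeneous_mode_estimate (m : ℕ) (γ : ℝ) (hγ1 : 1/2 ≤ γ) (hγ2 : γ < 1) :
    ∃ C > 0, ∀ k : ℤ, 3 ≤ |k| →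
      (∑ p ∈ Finset.range (m+1), ∑ q ∈ Finset.range (m+1-p),
        ENNReal.ofReal ((k:ℝ)^(2*q)) *
          ∫⁻ ψ in Ioc (0:ℝ) 1, ENNReal.ofReal (ψ ^ (2*((p:ℝ) - 1/2 - γ)) *
            |iteratedDeriv p (fun s : ℝ => s ^ ((((|k| : ℤ) : ℝ) - 1)/2)) ψ|^2))
      ≤ ENNReal.ofReal (C * (1 + (k:ℝ)^2) ^ ((m:ℝ) - 1/2)) := by
  have hγ' : 0 < 1 - γ := by linarith
  set A : ℝ := ((m : ℝ) + 1) ^ (2 * m) * (3 / (1 - γ)) with hA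
  have hA0 : 0 < A := by positivity
  refine ⟨∑ p ∈ Finset.range (m+1), ∑ _q ∈ Finset.range (m+1-p), A, ?_, fun k hk => ?_⟩
  · refine Finset.sum_pos (fun p hp => Finset.sum_pos (fun _ _ => hA0) ?_) (by simp)
    have := Finset.mem_range.mp hp
    exact Finset.nonempty_range_iff.mpr (by omega)
  have hK : (3 : ℝ) ≤ ((|k| : ℤ) : ℝ) := by exact_mod_cast hk
  have hKk : (((|k| : ℤ) : ℝ)) ^ 2 = (k : ℝ) ^ 2 := by push_cast; exact sq_abs _
  have hB : 0 ≤ (1 + (k : ℝ) ^ 2) ^ ((m : ℝ) - 1 / 2) := by positivity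
  simp only [Finset.sum_mul]
  rw [ENNReal.ofReal_sum_of_nonneg
    (fun _ _ => Finset.sum_nonneg fun _ _ => mul_nonneg hA0.le hB)]
  refine Finset.sum_le_sum fun p hp => ?_
  rw [ENNReal.ofReal_sum_of_nonneg (fun _ _ => mul_nonneg hA0.le hB)]
  refine Finset.sum_le_sum fun q hq => ?_
  have hpq : p + q ≤ m := by
    have := Finset.mem_range.mp hp
    have := Finset.mem_range.mp hq
    omega
  simp only [sub_sub (p : ℝ)]
  rw [lintegral_weighted_iteratedDeriv_rpow p (by linarith), pow_mul, ← hKk, ← pow_mul,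
    ← ENNReal.ofReal_mul (by positivity)]
  exact ENNReal.ofReal_le_ofReal
    (pow_mul_descPochhammer_sq_div_le (by linarith) hγ2 hK hpq)
end
end

section
/- Let ξ : ℝ → ℝ be a smooth 2π-periodic function with ξ(θ) > 0 for all θ. Then ∫₀^{2π} ( 2/ξ(θ)² + 3 ξ'(θ)²/ξ(θ)⁴ − ξ''(θ)/ξ(θ)³ ) e^{2iθ} dθ = 0, and likewise ∫₀^{2π} ( 2/ξ(θ)² + 3 ξ'(θ)²/ξ(θ)⁴ − ξ''(θ)/ξ(θ)³ ) e^{−2iθ} dθ = 0. -/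
open Real Set

noncomputable section

/-- With `u = 1/(2ξ²)`, the integrand is `(D²u + 4u) e^(cθ)`, and for `c² = -4` it has the periodic
antiderivative `(Du - c u) e^(cθ)`. -/
theorem integral_mul_exp_eq_zero_of_sq_eq_neg_four (ξ : ℝ → ℝ)
    (hξ : ContDiff ℝ 2 ξ) (hper : ∀ θ, ξ (θ + 2*π) = ξ θ)
    (hpos : ∀ θ, 0 < ξ θ) (c : ℂ) (hc : c ^ 2 = -4) (hexp : Complex.exp (c * (2 * π)) = 1) :
    ∫ θ in (0:ℝ)..(2*π),
        ((2/(ξ θ)^2 + 3*(deriv ξ θ)^2/(ξ θ)^4 - deriv (deriv ξ) θ/(ξ θ)^3 : ℝ) : ℂ) *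
          Complex.exp (c * (θ:ℂ)) = 0 := by
  have hξ' : ContDiff ℝ 1 (deriv ξ) := hξ.deriv'
  have h1 (θ : ℝ) : HasDerivAt ξ (deriv ξ θ) θ :=
    (hξ.differentiable (by norm_num) θ).hasDerivAt
  have h2 (θ : ℝ) : HasDerivAt (deriv ξ) (deriv (deriv ξ) θ) θ :=
    (hξ'.differentiable (by norm_num) θ).hasDerivAt
  have hne (θ : ℝ) : ξ θ ≠ 0 := (hpos θ).ne'
  have hu (θ : ℝ) : HasDerivAt (fun t => 1 / (2 * ξ t ^ 2)) (-deriv ξ θ / ξ θ ^ 3) θ := by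
    have hn := hne θ
    refine ((hasDerivAt_const θ (1:ℝ)).fun_div (((h1 θ).fun_pow 2).const_mul 2)
      (by positivity)).congr_deriv ?_
    field_simp
    ring
  have hv (θ : ℝ) : HasDerivAt (fun t => -deriv ξ t / ξ t ^ 3)
      (3 * (deriv ξ θ)^2 / (ξ θ)^4 - deriv (deriv ξ) θ / (ξ θ)^3) θ := by
    have hn := hne θ
    refine ((h2 θ).fun_neg.fun_div ((h1 θ).fun_pow 3) (by positivity)).congr_deriv ?_
    field_simp
    ring
  have hE (θ : ℝ) : HasDerivAt (fun t : ℝ => Complex.exp (c * (t:ℂ)))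
      (Complex.exp (c * (θ:ℂ)) * c) θ := by
    simpa using ((hasDerivAt_id θ).ofReal_comp.const_mul c).cexp
  have hF (θ : ℝ) : HasDerivAt
      (fun t : ℝ => (((-deriv ξ t / ξ t ^ 3 : ℝ) : ℂ) - c * ((1 / (2 * ξ t ^ 2) : ℝ) : ℂ)) *
        Complex.exp (c * (t:ℂ)))
      (((2/(ξ θ)^2 + 3*(deriv ξ θ)^2/(ξ θ)^4 - deriv (deriv ξ) θ/(ξ θ)^3 : ℝ) : ℂ) *
          Complex.exp (c * (θ:ℂ))) θ := by
    have hsplit : (2/(ξ θ)^2 + 3*(deriv ξ θ)^2/(ξ θ)^4 - deriv (deriv ξ) θ/(ξ θ)^3 : ℝ)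
        = (3*(deriv ξ θ)^2/(ξ θ)^4 - deriv (deriv ξ) θ/(ξ θ)^3) + 4 * (1 / (2 * ξ θ ^ 2)) := by
      have hn := hne θ
      field_simp
      ring
    refine (((hv θ).ofReal_comp.fun_sub ((hu θ).ofReal_comp.const_mul c)).fun_mul
      (hE θ)).congr_deriv ?_
    rw [hsplit, Complex.ofReal_add, Complex.ofReal_mul, Complex.ofReal_ofNat]
    linear_combination -((1 / (2 * ξ θ ^ 2) : ℝ) : ℂ) * Complex.exp (c * (θ:ℂ)) * hc
  have hcont : Continuous fun θ : ℝ =>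
      ((2/(ξ θ)^2 + 3*(deriv ξ θ)^2/(ξ θ)^4 - deriv (deriv ξ) θ/(ξ θ)^3 : ℝ) : ℂ) *
          Complex.exp (c * (θ:ℂ)) := by
    have c0 := hξ.continuous
    have c1 := hξ'.continuous
    have c2 : Continuous (deriv (deriv ξ)) := hξ'.continuous_deriv le_rfl
    have hn2 (θ : ℝ) : ξ θ ^ 2 ≠ 0 := pow_ne_zero _ (hne θ)
    have hn3 (θ : ℝ) : ξ θ ^ 3 ≠ 0 := pow_ne_zero _ (hne θ)
    have hn4 (θ : ℝ) : ξ θ ^ 4 ≠ 0 := pow_ne_zero _ (hne θ)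
    fun_prop (disch := assumption)
  have hper' : deriv ξ (2 * π) = deriv ξ 0 := by
    have h : (fun t => ξ (t + 2 * π)) = ξ := funext hper
    have := deriv_comp_add_const ξ (2 * π) 0
    rw [h, zero_add] at this
    exact this.symm
  have hper0 : ξ (2 * π) = ξ 0 := by simpa using hper 0
  rw [intervalIntegral.integral_eq_sub_of_hasDerivAt (fun θ _ => hF θ)
    (hcont.intervalIntegrable _ _), hper', hper0]
  push_cast
  simp [hexp]

/-- **Vanishing of the second Fourier coefficients of `Ξ(ψ^(1/2) ξ)`**:
for smooth positive `2π`-periodic `ξ`,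
`∫₀^(2π) (2/ξ² + 3(ξ')²/ξ⁴ − ξ''/ξ³) e^(±2iθ) dθ = 0`. -/
theorem second_fourier_coefficients_vanish (ξ : ℝ → ℝ)
    (hξ : ContDiff ℝ (⊤ : ℕ∞) ξ) (hper : ∀ θ, ξ (θ + 2*π) = ξ θ)
    (hpos : ∀ θ, 0 < ξ θ) :
    (∫ θ in (0:ℝ)..(2*π),
        ((2/(ξ θ)^2 + 3*(deriv ξ θ)^2/(ξ θ)^4 - deriv (deriv ξ) θ/(ξ θ)^3 : ℝ) : ℂ) *
          Complex.exp (2 * Complex.I * (θ:ℂ)) = 0) ∧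
    (∫ θ in (0:ℝ)..(2*π),
        ((2/(ξ θ)^2 + 3*(deriv ξ θ)^2/(ξ θ)^4 - deriv (deriv ξ) θ/(ξ θ)^3 : ℝ) : ℂ) *
          Complex.exp (-(2 * Complex.I * (θ:ℂ))) = 0) := by
  have hξ2 : ContDiff ℝ 2 ξ := contDiff_infty.1 hξ 2
  constructor
  · refine integral_mul_exp_eq_zero_of_sq_eq_neg_four ξ hξ2 hper hpos (2 * Complex.I) ?_ ?_
    · rw [mul_pow, Complex.I_sq]
      norm_num
    · exact Complex.exp_eq_one_iff.2 ⟨2, by push_cast; ring⟩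
  · simp only [← neg_mul (2 * Complex.I)]
    refine integral_mul_exp_eq_zero_of_sq_eq_neg_four ξ hξ2 hper hpos (-(2 * Complex.I)) ?_ ?_
    · rw [neg_sq, mul_pow, Complex.I_sq]
      norm_num
    · exact Complex.exp_eq_one_iff.2 ⟨-2, by push_cast; ring⟩
end
end
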